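/- arXiv:1408.2882 — 4 statements merged into one kernel-verified Lean document; each statement's English description precedes it below -/
import Mathlib

section
/- Let α = (α_1,…,α_M) and μ = (μ_1,…,μ_N) be nonnegative nonincreasing real sequences with M ≤ N. Define β_M, β_{M−1}, …, β_1 recursively: for each k = M, M−1, …, 1, given β_{k+1},…,β_M, let S_k := {t ∈ ℝ : Σ_{m=j}^{k} (t − α_{m−j+1})^+ + Σ_{m=k+1}^{M} (β_m − α_{m−j+1})^+ ≤ Σ_{n=j}^{N} μ_n for all j = 1,…,k}, and let β_k := sup S_k. Then for each k the set S_k is nonempty, bounded above, and contains its supremum (so β_k = max S_k is well-defined); the resulting sequence β = (β_1,…,β_M) is an (α,μ)-completion; and β is minimal with respect to majorization: for every (α,μ)-completion λ = (λ_1,…,λ_M), one has Σ_{m=1}^{j} β_m ≤ Σ_{m=1}^{j} λ_m for all j = 1,…,M (and Σ_{m=1}^{M} β_m = Σ_{m=1}^{M} λ_m). -/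
open Finset

/-- `a 1, …, a M` is a nonnegative nonincreasing sequence. -/
def NonnegNonincrOn (M : ℕ) (a : ℕ → ℝ) : Prop :=
  (∀ m, 1 ≤ m → m ≤ M → 0 ≤ a m) ∧ ∀ m, 1 ≤ m → m < M → a (m + 1) ≤ a m

/-- `lam` is an `(α,μ)`-completion: it is nonnegative nonincreasing, and it is the spectrum
(with multiplicity) of `A + ∑ₙ φₙ φₙ*` for some self-adjoint `A` with spectrum `α` and
vectors `φₙ ∈ ℂ^M` with `‖φₙ‖² = μₙ`. -/
def IsCompletion (M N : ℕ) (α μ lam : ℕ → ℝ) : Prop :=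
  NonnegNonincrOn M lam ∧
  ∃ (A : Matrix (Fin M) (Fin M) ℂ) (hA : A.IsHermitian)
    (φ : Fin N → Fin M → ℂ)
    (hB : (A + ∑ n : Fin N, Matrix.vecMulVec (φ n) (star (φ n))).IsHermitian)
    (σ τ : Equiv.Perm (Fin M)),
      (∀ i : Fin M, hA.eigenvalues i = α ((σ i : ℕ) + 1)) ∧
      (∀ n : Fin N, ∑ i, ‖φ n i‖ ^ 2 = μ ((n : ℕ) + 1)) ∧
      (∀ i : Fin M, hB.eigenvalues i = lam ((τ i : ℕ) + 1))

/-- The sequence `l` with all parts removed that lie above the copy of `a` shifted by `i` and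
whose removal leaves an interlacing sequence. -/
noncomputable def trim (a l : ℕ → ℝ) (i m : ℕ) : ℝ :=
  max (l (m + 1)) (if m < i then l m else min (l m) (a (m - i)))

lemma le_trim (a l : ℕ → ℝ) (i m : ℕ) : l (m + 1) ≤ trim a l i m := le_max_left _ _

lemma trim_le {a l : ℕ → ℝ} (hl : Antitone l) (i m : ℕ) : trim a l i m ≤ l m := by
  refine max_le (hl (Nat.le_succ m)) ?_
  split_ifs
  exacts [le_rfl, min_le_left _ _]

lemma min_le_trim {a : ℕ → ℝ} (l : ℕ → ℝ) (ha : Antitone a) {i j : ℕ} (hij : j ≤ i) (m : ℕ) :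
    min (l m) (a (m - j)) ≤ trim a l i m := by
  refine le_max_of_le_right ?_
  split_ifs
  · exact min_le_left _ _
  · exact min_le_min_left _ (ha (by omega))

lemma trim_le_max {a : ℕ → ℝ} (l : ℕ → ℝ) (ha : Antitone a) {i j m : ℕ} (hij : i ≤ j)
    (hjm : j ≤ m) : trim a l i m ≤ max (l (m + 1)) (a (m - j)) := by
  refine max_le_max_left _ ?_
  rw [if_neg (by omega)]
  exact (min_le_right _ _).trans (ha (by omega))

/-- Discrete intermediate value theorem. -/
lemma exists_le_le_succ {f : ℕ → ℝ} {c : ℝ} {n : ℕ} (h0 : f 0 ≤ c) (hn : c ≤ f (n + 1)) :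
    ∃ i ≤ n, f i ≤ c ∧ c ≤ f (i + 1) := by
  induction n with
  | zero => exact ⟨0, le_rfl, h0, hn⟩
  | succ n ih =>
    by_cases h : c ≤ f (n + 1)
    · obtain ⟨i, hi, h'⟩ := ih h
      exact ⟨i, by omega, h'⟩
    · exact ⟨n + 1, le_rfl, (not_le.1 h).le, hn⟩

/-- The inequalities characterising when `l` is the spectrum of a matrix with spectrum `a` plus
rank-one matrices with traces `u 0, …, u (N - 1)`. -/
structure Attainable (M N : ℕ) (a u l : ℕ → ℝ) : Prop where
  antitone : Antitone l
  eq_zero : ∀ m, M ≤ m → l m = 0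
  le : ∀ m, a m ≤ l m
  sum_eq : ∑ m ∈ range M, l m = ∑ m ∈ range M, a m + ∑ n ∈ range N, u n
  excess : ∀ j, ∑ m ∈ Ico j M, max (l m - a (m - j)) 0 ≤ ∑ n ∈ Ico j N, u n

lemma Attainable.shift_excess {M N : ℕ} {a u l : ℕ → ℝ} (h : Attainable M (N + 1) a u l)
    (ha0 : ∀ m, 0 ≤ a m) (hu : Antitone u) (hu0 : ∀ n, 0 ≤ u n) (j : ℕ) :
    ∑ m ∈ Ico j M, max (l (m + 1) - a (m - j)) 0 ≤ ∑ n ∈ Ico j N, u n := by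
  rcases le_or_gt M j with hj | hj
  · rw [Ico_eq_empty_of_le hj, sum_empty]
    exact sum_nonneg fun n _ => hu0 n
  have h1 : ∑ m ∈ Ico j M, max (l (m + 1) - a (m - j)) 0
      = ∑ m ∈ Ico (j + 1) (M + 1), max (l m - a (m - (j + 1))) 0 := by
    rw [← sum_Ico_add' (fun m => max (l m - a (m - (j + 1))) 0) j M 1]
    refine sum_congr rfl fun m _ => ?_
    rw [Nat.add_sub_add_right]
  have h2 : max (l M - a (M - (j + 1))) 0 = 0 := by
    rw [h.eq_zero M le_rfl]
    exact max_eq_right (by linarith [ha0 (M - (j + 1))])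
  rw [h1, sum_Ico_succ_top (by omega), h2, add_zero]
  refine (h.excess (j + 1)).trans ?_
  rw [← sum_Ico_add' u j N 1]
  exact sum_le_sum fun n _ => hu (Nat.le_succ n)

/-- Removing the last trace `u N`: some sequence interlacing `l` is attainable from the remaining
ones. -/
lemma Attainable.exists_interlacing {M N : ℕ} {a u l : ℕ → ℝ} (h : Attainable M (N + 1) a u l)
    (ha : Antitone a) (ha0 : ∀ m, 0 ≤ a m) (hu : Antitone u) (hu0 : ∀ n, 0 ≤ u n) :
    ∃ g, Attainable M N a u g ∧ (∀ m, g m ≤ l m) ∧ ∀ m, l (m + 1) ≤ g m := by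
  set f : ℕ → ℝ := fun i => ∑ m ∈ range M, trim a l i m with hf
  set c : ℝ := ∑ m ∈ range M, l m - u N with hc
  have hsum := h.sum_eq
  rw [sum_range_succ] at hsum
  have h0 : f 0 ≤ c := by
    have h1 := h.shift_excess ha0 hu hu0 0
    rw [← range_eq_Ico, ← range_eq_Ico] at h1
    have h2 : f 0 ≤ ∑ m ∈ range M, (a m + max (l (m + 1) - a (m - 0)) 0) := by
      refine sum_le_sum fun m _ => (trim_le_max l ha le_rfl (Nat.zero_le m)).trans ?_
      rw [Nat.sub_zero]
      refine max_le ?_ ?_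
      · linarith [le_max_left (l (m + 1) - a m) 0]
      · linarith [le_max_right (l (m + 1) - a m) 0]
    rw [sum_add_distrib] at h2
    linarith
  have hN : c ≤ f (N + 1) := by
    have h1 : f (N + 1) = ∑ m ∈ range M, l m := by
      refine sum_congr rfl fun m hm => le_antisymm (trim_le h.antitone _ _) ?_
      refine le_max_of_le_right ?_
      split_ifs with hmN
      · exact le_rfl
      refine le_min le_rfl ?_
      have h2 := h.excess (N + 1)
      rw [Ico_self, sum_empty] at h2
      have h3 := single_le_sum (f := fun m => max (l m - a (m - (N + 1))) 0)
        (fun m _ => le_max_right _ _) (mem_Ico.2 ⟨not_lt.1 hmN, mem_range.1 hm⟩)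
      linarith [le_max_left (l m - a (m - (N + 1))) 0]
    linarith [hu0 N]
  obtain ⟨i, hi, hfi, hfi'⟩ := exists_le_le_succ h0 hN
  obtain ⟨s, t, hs, ht, hst, hc'⟩ : ∃ s t : ℝ, 0 ≤ s ∧ 0 ≤ t ∧ s + t = 1 ∧
      s * f i + t * f (i + 1) = c := by
    have h1 : c ∈ segment ℝ (f i) (f (i + 1)) := by
      rw [segment_eq_Icc (hfi.trans hfi')]
      exact ⟨hfi, hfi'⟩
    simpa [segment] using h1
  set g : ℕ → ℝ := fun m => s * trim a l i m + t * trim a l (i + 1) m with hg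
  have upper : ∀ m b, trim a l i m ≤ b → trim a l (i + 1) m ≤ b → g m ≤ b := fun m b h1 h2 => by
    calc g m ≤ s * b + t * b := by simp only [hg]; gcongr
      _ = b := by rw [← add_mul, hst, one_mul]
  have lower : ∀ m b, b ≤ trim a l i m → b ≤ trim a l (i + 1) m → b ≤ g m := fun m b h1 h2 => by
    calc b = s * b + t * b := by rw [← add_mul, hst, one_mul]
      _ ≤ g m := by simp only [hg]; gcongr
  have hgl : ∀ m, g m ≤ l m := fun m =>
    upper m _ (trim_le h.antitone _ _) (trim_le h.antitone _ _)
  have hlg : ∀ m, l (m + 1) ≤ g m := fun m => lower m _ (le_trim _ _ _ _) (le_trim _ _ _ _)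
  have hming : ∀ {j} m, j ≤ i → min (l m) (a (m - j)) ≤ g m := fun m hj =>
    lower m _ (min_le_trim l ha hj m) (min_le_trim l ha (by omega) m)
  have hgsum : ∑ m ∈ range M, g m = ∑ m ∈ range M, l m - u N := by
    rw [← hc, ← hc', sum_add_distrib, ← mul_sum, ← mul_sum]
  refine ⟨g, ⟨antitone_nat_of_succ_le fun m => (hgl _).trans (hlg m), fun m hm => ?_, fun m => ?_,
    by linarith, fun j => ?_⟩, hgl, hlg⟩
  · refine le_antisymm ((hgl m).trans_eq (h.eq_zero m hm)) ?_
    rw [← h.eq_zero (m + 1) (by omega)]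
    exact hlg m
  · refine le_trans ?_ (hming (j := 0) m (Nat.zero_le i))
    exact le_min (h.le m) le_rfl
  · rcases le_or_gt j i with hj | hj
    · rcases le_or_gt M j with hjM | hjM
      · rw [Ico_eq_empty_of_le hjM, sum_empty]
        exact sum_nonneg fun n _ => hu0 n
      have h1 : ∑ m ∈ Ico j M, max (g m - a (m - j)) 0
          ≤ ∑ m ∈ Ico j M, (max (l m - a (m - j)) 0 - (l m - g m)) := by
        refine sum_le_sum fun m _ => ?_
        have h2 := hming m hj
        have h3 := hgl m
        rcases le_total (l m) (a (m - j)) with h4 | h4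
        · rw [min_eq_left h4] at h2
          rw [max_eq_right (by linarith), max_eq_right (by linarith)]
          linarith
        · rw [min_eq_right h4] at h2
          rw [max_eq_left (by linarith), max_eq_left (by linarith)]
          linarith
      have h2 : ∑ m ∈ range j, (l m - g m) = 0 := by
        refine sum_eq_zero fun m hm => ?_
        have hm' := mem_range.1 hm
        have h3 : l m ≤ g m := lower m _
          (le_max_of_le_right (by rw [if_pos (by omega)]))
          (le_max_of_le_right (by rw [if_pos (by omega)]))
        linarith [hgl m]
      have h3 := sum_range_add_sum_Ico (fun m => l m - g m) hjM.le
      have h4 := h.excess j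
      rw [sum_Ico_succ_top (by omega)] at h4
      rw [sum_sub_distrib] at h1
      rw [sum_sub_distrib (s := range M)] at h3
      linarith
    · refine le_trans (sum_le_sum fun m hm => ?_) (h.shift_excess ha0 hu hu0 j)
      have hjm := (mem_Ico.1 hm).1
      have h1 := upper m _ (trim_le_max l ha (by omega) hjm) (trim_le_max l ha hj hjm)
      refine max_le ?_ (le_max_right _ _)
      rcases le_total (l (m + 1)) (a (m - j)) with h2 | h2
      · rw [max_eq_right h2] at h1
        exact le_max_of_le_right (by linarith)
      · rw [max_eq_left h2] at h1
        exact le_max_of_le_left (by linarith)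

/-- Partial fraction coefficients realising a strictly interlacing sequence as the roots of a
secular equation. -/
lemma exists_weights_of_lt {M : ℕ} {g l : Fin M → ℝ} (h1 : ∀ i, g i < l i)
    (h2 : ∀ i j, i < j → l j < g i) :
    ∃ w : Fin M → ℝ, (∀ i, 0 ≤ w i) ∧ ∀ x : ℝ,
      ∏ i, (x - g i) - ∑ i, w i * ∏ j ∈ univ.erase i, (x - g j) = ∏ i, (x - l i) := by
  have hg : ∀ i j, i < j → g j < g i := fun i j hij => (h1 j).trans (h2 i j hij)
  have hne : ∀ i j, j ≠ i → g i - g j ≠ 0 := fun i j hij => by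
    rcases lt_or_gt_of_ne hij with h | h
    · exact (sub_neg.2 (hg _ _ h)).ne
    · exact (sub_pos.2 (hg _ _ h)).ne'
  have hinj : Function.Injective g := fun i j hij => by
    by_contra h
    exact hne i j (Ne.symm h) (sub_eq_zero.2 hij)
  refine ⟨fun i => (l i - g i) * ∏ j ∈ univ.erase i, ((g i - l j) / (g i - g j)), fun i => ?_, ?_⟩
  · refine mul_nonneg (sub_nonneg.2 (h1 i).le) (prod_nonneg fun j hj => ?_)
    rcases lt_or_gt_of_ne (ne_of_mem_erase hj) with h | h
    · exact div_nonneg_of_nonpos (by linarith [h1 j, hg j i h]) (by linarith [hg j i h])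
    · exact div_nonneg (by linarith [h2 i j h]) (by linarith [hg i j h])
  set w : Fin M → ℝ := fun i => (l i - g i) * ∏ j ∈ univ.erase i, ((g i - l j) / (g i - g j))
    with hw
  open Polynomial in
  have key : ∏ i, (X - C (g i)) - ∏ i, (X - C (l i))
      = ∑ i, C (w i) * ∏ j ∈ univ.erase i, (X - C (g j)) := by
    refine Polynomial.eq_of_degrees_lt_of_eval_index_eq univ (v := g) hinj.injOn ?_ ?_ ?_
    · have h3 := Lagrange.degree_nodal (s := univ) (v := g)
      have h4 := Lagrange.degree_nodal (s := univ) (v := l)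
      rw [← h3]
      refine Polynomial.degree_sub_lt_left (h3.trans h4.symm) (Lagrange.nodal_ne_zero) ?_
      exact (Lagrange.nodal_monic (s := univ) (v := g)).leadingCoeff.trans
        (Lagrange.nodal_monic (s := univ) (v := l)).leadingCoeff.symm
    · refine (Polynomial.degree_sum_le _ _).trans_lt ?_
      rw [Finset.sup_lt_iff (by simp)]
      intro i _
      rw [Polynomial.C_mul']
      refine (Polynomial.degree_smul_le _ _).trans_lt ?_
      refine (Lagrange.degree_nodal (s := univ.erase i) (v := g)).trans_lt ?_
      exact_mod_cast card_erase_lt_of_mem (mem_univ i)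
    · intro i _
      simp only [Polynomial.eval_sub, Polynomial.eval_prod, Polynomial.eval_finsetSum,
        Polynomial.eval_mul, Polynomial.eval_X, Polynomial.eval_C]
      rw [sum_eq_single i, prod_eq_zero (mem_univ i) (sub_self _),
        ← mul_prod_erase univ _ (mem_univ i), hw, mul_assoc, ← prod_mul_distrib,
        prod_congr rfl fun j hj => div_mul_cancel₀ (g i - l j) (hne i j (ne_of_mem_erase hj))]
      · ring
      · intro j _ hji
        rw [prod_eq_zero (mem_erase.2 ⟨hji.symm, mem_univ i⟩) (sub_self _), mul_zero]
      · simp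
  intro x
  have := congrArg (Polynomial.eval x) key
  simp only [Polynomial.eval_sub, Polynomial.eval_prod, Polynomial.eval_finsetSum,
    Polynomial.eval_mul, Polynomial.eval_X, Polynomial.eval_C] at this
  linarith

lemma exists_weights {M : ℕ} {g l : Fin M → ℝ} (h1 : ∀ i, g i ≤ l i)
    (h2 : ∀ i j, i < j → l j ≤ g i) :
    ∃ w : Fin M → ℝ, (∀ i, 0 ≤ w i) ∧ ∀ x : ℝ,
      ∏ i, (x - g i) - ∑ i, w i * ∏ j ∈ univ.erase i, (x - g j) = ∏ i, (x - l i) := by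
  set e : ℕ → ℝ := fun k => 1 / ((k : ℝ) + 1) with he
  have he0 : ∀ k, 0 < e k := fun k => by positivity
  have he1 : ∀ k, e k ≤ 1 := fun k => by
    simp only [he]
    rw [div_le_one (by positivity)]
    linarith [(Nat.cast_nonneg k : (0:ℝ) ≤ k)]
  have hlim : Filter.Tendsto e Filter.atTop (nhds 0) := tendsto_one_div_add_atTop_nhds_zero_nat
  set G : ℕ → Fin M → ℝ := fun k i => g i - (2 * i + 1) * e k with hG
  set L : ℕ → Fin M → ℝ := fun k i => l i - 2 * i * e k with hL
  have hex : ∀ k, ∃ w : Fin M → ℝ, (∀ i, 0 ≤ w i) ∧ ∀ x : ℝ,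
      ∏ i, (x - G k i) - ∑ i, w i * ∏ j ∈ univ.erase i, (x - G k j) = ∏ i, (x - L k i) := by
    refine fun k => exists_weights_of_lt (fun i => ?_) fun i j hij => ?_
    · simp only [hG, hL]
      linarith [h1 i, he0 k]
    · have h3 : (i : ℝ) + 1 ≤ j := by exact_mod_cast (hij : (i : ℕ) < j)
      simp only [hG, hL]
      nlinarith [h2 i j hij, he0 k, mul_le_mul_of_nonneg_right h3 (he0 k).le]
  choose w hw0 hw using hex
  have hGlim : ∀ i, Filter.Tendsto (fun k => G k i) Filter.atTop (nhds (g i)) := fun i => by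
    simpa using (hlim.const_mul (2 * (i : ℝ) + 1)).const_sub (g i)
  have hLlim : ∀ i, Filter.Tendsto (fun k => L k i) Filter.atTop (nhds (l i)) := fun i => by
    simpa using (hlim.const_mul (2 * (i : ℝ))).const_sub (l i)
  obtain ⟨B, hB⟩ : ∃ B : ℝ, ∀ i, |g i| ≤ B ∧ |l i| ≤ B := by
    refine ⟨∑ i, (|g i| + |l i|), fun i => ?_⟩
    have := single_le_sum (f := fun i => |g i| + |l i|) (fun i _ => by positivity) (mem_univ i)
    constructor <;> linarith [abs_nonneg (g i), abs_nonneg (l i)]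
  have hGL : ∀ k i, G k i < B + 1 ∧ L k i < B + 1 ∧ -(B + 2 * M + 1) ≤ G k i := fun k i => by
    have h3 : (i : ℝ) ≤ M := by exact_mod_cast i.2.le
    have h4 : (0 : ℝ) ≤ i := Nat.cast_nonneg _
    have h5 := abs_le.1 (hB i).1
    have h6 := abs_le.1 (hB i).2
    have h7 := mul_le_mul_of_nonneg_left (he1 k) h4
    have h8 := mul_nonneg h4 (he0 k).le
    simp only [hG, hL]
    refine ⟨?_, ?_, ?_⟩ <;> linarith [he0 k, he1 k]
  have hwB : ∀ k, w k ∈ Set.Icc (0 : Fin M → ℝ) fun _ => 2 * B + 2 * M + 2 := fun k => by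
    refine ⟨hw0 k, fun i => ?_⟩
    have h3 := hw k (B + 1)
    have h4 : 0 ≤ ∏ i, (B + 1 - L k i) := prod_nonneg fun i _ => by linarith [(hGL k i).2.1]
    have h5 := single_le_sum (f := fun i => w k i * ∏ j ∈ univ.erase i, (B + 1 - G k j))
      (fun i _ => mul_nonneg (hw0 k i) (prod_nonneg fun j _ => by linarith [(hGL k j).1]))
      (mem_univ i)
    have h6 : 0 < ∏ j ∈ univ.erase i, (B + 1 - G k j) :=
      prod_pos fun j _ => by linarith [(hGL k j).1]
    rw [← mul_prod_erase univ _ (mem_univ i)] at h3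
    have h7 : w k i ≤ B + 1 - G k i := le_of_mul_le_mul_right (by linarith) h6
    linarith [(hGL k i).2.2]
  obtain ⟨w', hw', ψ, hψ, hlim'⟩ := isCompact_Icc.tendsto_subseq hwB
  refine ⟨w', hw'.1, fun x => ?_⟩
  have hlimG := fun i => (hGlim i).comp hψ.tendsto_atTop
  have hlimL := fun i => (hLlim i).comp hψ.tendsto_atTop
  have hlimw := fun i => tendsto_pi_nhds.1 hlim' i
  have t1 := (tendsto_finsetProd univ fun i _ => (hlimG i).const_sub x).sub
    (tendsto_finsetSum univ fun i _ => (hlimw i).mul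
      (tendsto_finsetProd (univ.erase i) fun j _ => (hlimG j).const_sub x))
  have t2 := tendsto_finsetProd univ fun i _ => (hlimL i).const_sub x
  exact tendsto_nhds_unique (t1.congr fun k => hw (ψ k) x) t2

lemma exists_perm_of_map_univ_eq {ι κ : Type*} [Fintype ι] {f g : ι → κ}
    (h : (univ.val.map f : Multiset κ) = univ.val.map g) :
    ∃ σ : Equiv.Perm ι, ∀ i, f i = g (σ i) := by
  classical
  have hcard : ∀ c, Fintype.card {i // f i = c} = Fintype.card {i // g i = c} := fun c => by
    have := congrArg (Multiset.count c) h
    rw [Multiset.count_map, Multiset.count_map] at this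
    rw [Fintype.card_subtype, Fintype.card_subtype, card_def, card_def, filter_val, filter_val]
    simpa only [eq_comm] using this
  refine ⟨Equiv.ofFiberEquiv fun c => Fintype.equivOfCardEq (hcard c), fun i => ?_⟩
  exact (Equiv.ofFiberEquiv_map (fun c => Fintype.equivOfCardEq (hcard c)) i).symm

lemma Matrix.IsHermitian.exists_perm_eigenvalues {M : ℕ} {A : Matrix (Fin M) (Fin M) ℂ}
    (hA : A.IsHermitian) {a : Fin M → ℝ}
    (h : A.charpoly = ∏ i, (Polynomial.X - Polynomial.C (a i : ℂ))) :
    ∃ σ : Equiv.Perm (Fin M), ∀ i, hA.eigenvalues i = a (σ i) := by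
  have h1 := hA.roots_charpoly_eq_eigenvalues
  have h2 : A.charpoly.roots = univ.val.map fun i => (a i : ℂ) := by
    rw [h, prod_eq_multiset_prod, ← Polynomial.roots_multiset_prod_X_sub_C
      (univ.val.map fun i => (a i : ℂ)), Multiset.map_map]
    rfl
  obtain ⟨σ, hσ⟩ := exists_perm_of_map_univ_eq (h1.symm.trans h2)
  exact ⟨σ, fun i => Complex.ofReal_injective (hσ i)⟩

lemma Matrix.eval_charpoly_diagonal_add_vecMulVec {M : ℕ} (e s : Fin M → ℂ) {x : ℂ}
    (hx : ∀ i, x - e i ≠ 0) :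
    (Matrix.diagonal e + Matrix.vecMulVec s (star s)).charpoly.eval x
      = (∏ i, (x - e i)) * (1 - ∑ i, s i * star (s i) / (x - e i)) := by
  have h : Matrix.scalar (Fin M) x - (Matrix.diagonal e + Matrix.vecMulVec s (star s))
      = Matrix.diagonal (fun i => x - e i) * (1 + Matrix.replicateCol Unit
        (fun i => -(s i / (x - e i))) * Matrix.replicateRow Unit (star s)) := by
    rw [← Matrix.vecMulVec_eq]
    ext i j
    have := hx i
    rw [Matrix.diagonal_mul]
    by_cases hij : i = j
    · subst hij
      simp [Matrix.vecMulVec_apply]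
      field_simp
      ring
    · simp [Matrix.vecMulVec_apply, hij]
      field_simp
  rw [Matrix.eval_charpoly, h, Matrix.det_mul, Matrix.det_diagonal,
    Matrix.det_one_add_replicateCol_mul_replicateRow, sub_eq_add_neg 1, ← sum_neg_distrib]
  congr 2
  refine sum_congr rfl fun i _ => ?_
  simp only [Pi.star_apply]
  ring

/-- A spectrum interlacing that of `C` is attained by a rank-one perturbation of `C`. -/
lemma Matrix.IsHermitian.exists_vecMulVec_charpoly {M : ℕ} {C : Matrix (Fin M) (Fin M) ℂ}
    (hC : C.IsHermitian) {g l : Fin M → ℝ}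
    (h : C.charpoly = ∏ i, (Polynomial.X - Polynomial.C (g i : ℂ)))
    (h1 : ∀ i, g i ≤ l i) (h2 : ∀ i j, i < j → l j ≤ g i) :
    ∃ v : Fin M → ℂ, (C + Matrix.vecMulVec v (star v)).charpoly
      = ∏ i, (Polynomial.X - Polynomial.C (l i : ℂ)) := by
  obtain ⟨σ, hσ⟩ := hC.exists_perm_eigenvalues h
  obtain ⟨w, hw0, hw⟩ := exists_weights h1 h2
  set U : Matrix (Fin M) (Fin M) ℂ := hC.eigenvectorUnitary.1 with hU
  set e : Fin M → ℂ := fun i => (g (σ i) : ℂ) with he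
  set s : Fin M → ℂ := fun i => (√(w (σ i)) : ℂ) with hs
  have hspec : C = U * Matrix.diagonal e * star U := by
    conv_lhs => rw [hC.spectral_theorem, Unitary.conjStarAlgAut_apply]
    congr 3
    funext i
    simp [he, hσ]
  have hUU : star U * U = 1 := Unitary.coe_star_mul_self _
  refine ⟨U.mulVec s, ?_⟩
  have hconj : C + Matrix.vecMulVec (U.mulVec s) (star (U.mulVec s))
      = U * ((Matrix.diagonal e + Matrix.vecMulVec s (star s)) * star U) := by
    rw [Matrix.star_mulVec, ← Matrix.mul_vecMulVec, ← Matrix.vecMulVec_mul, hspec,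
      Matrix.star_eq_conjTranspose]
    noncomm_ring
  rw [hconj, Matrix.charpoly_mul_comm, mul_assoc, hUU, mul_one]
  refine Polynomial.eq_of_infinite_eval_eq _ _ ?_
  have hfin : (Set.range g)ᶜ.Infinite := (Set.finite_range g).infinite_compl
  refine (hfin.image Complex.ofReal_injective.injOn).mono ?_
  rintro _ ⟨x, hx, rfl⟩
  have hx' : ∀ i, x - g i ≠ 0 := fun i hi => hx ⟨i, by linarith⟩
  have hr : (∏ i, (x - g i)) * (1 - ∑ i, w i / (x - g i)) = ∏ i, (x - l i) := by
    rw [← hw x, mul_sub, mul_one, mul_sum]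
    congr 1
    refine sum_congr rfl fun i _ => ?_
    rw [← mul_prod_erase univ _ (mem_univ i)]
    have := hx' i
    field_simp
  rw [Set.mem_ofPred_eq, Matrix.eval_charpoly_diagonal_add_vecMulVec e s
    fun i => by simp only [he]; exact_mod_cast hx' (σ i)]
  have hs2 : ∀ i, s i * star (s i) = (w (σ i) : ℂ) := fun i => by
    simp only [hs, RCLike.star_def, Complex.conj_ofReal]
    rw [← Complex.ofReal_mul, Real.mul_self_sqrt (hw0 _)]
  simp only [hs2, he]
  rw [Equiv.prod_comp σ (fun i => (x : ℂ) - g i),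
    Equiv.sum_comp σ (fun i => (w i : ℂ) / ((x : ℂ) - g i)), Polynomial.eval_prod]
  simp only [Polynomial.eval_sub, Polynomial.eval_X, Polynomial.eval_C]
  exact_mod_cast congrArg (fun r : ℝ => (r : ℂ)) hr

lemma Matrix.isHermitian_vecMulVec_star {M : ℕ} (v : Fin M → ℂ) :
    (Matrix.vecMulVec v (star v)).IsHermitian := by
  rw [Matrix.IsHermitian, Matrix.conjTranspose_vecMulVec, star_star]

lemma Matrix.isHermitian_add_sum_vecMulVec {M : ℕ} {ι : Type*} {A : Matrix (Fin M) (Fin M) ℂ}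
    (hA : A.IsHermitian) (s : Finset ι) (φ : ι → Fin M → ℂ) :
    (A + ∑ n ∈ s, Matrix.vecMulVec (φ n) (star (φ n))).IsHermitian :=
  hA.add (isSelfAdjoint_sum s fun n _ => Matrix.isHermitian_vecMulVec_star (φ n))

lemma Matrix.trace_vecMulVec_star {M : ℕ} (v : Fin M → ℂ) :
    (Matrix.vecMulVec v (star v)).trace = ((∑ i, ‖v i‖ ^ 2 : ℝ) : ℂ) := by
  rw [Matrix.trace_vecMulVec, dotProduct, Complex.ofReal_sum]
  refine sum_congr rfl fun i _ => ?_
  rw [Pi.star_apply, RCLike.star_def, Complex.mul_conj']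
  norm_cast

lemma Matrix.trace_eq_of_charpoly {M : ℕ} {A : Matrix (Fin M) (Fin M) ℂ} {a : Fin M → ℝ}
    (h : A.charpoly = ∏ i, (Polynomial.X - Polynomial.C (a i : ℂ))) :
    A.trace = ((∑ i, a i : ℝ) : ℂ) := by
  rw [Matrix.trace_eq_sum_roots_charpoly, h, prod_eq_multiset_prod]
  have : (univ.val.map fun i => Polynomial.X - Polynomial.C (a i : ℂ))
      = (univ.val.map fun i => (a i : ℂ)).map fun c => Polynomial.X - Polynomial.C c := by
    rw [Multiset.map_map]
    rfl
  rw [this, Polynomial.roots_multiset_prod_X_sub_C, Complex.ofReal_sum]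
  rfl

lemma Attainable.exists_matrix {M N : ℕ} {a u l : ℕ → ℝ} (h : Attainable M N a u l)
    (ha : Antitone a) (ha0 : ∀ m, 0 ≤ a m) (hu : Antitone u) (hu0 : ∀ n, 0 ≤ u n) :
    ∃ (A : Matrix (Fin M) (Fin M) ℂ) (φ : Fin N → Fin M → ℂ), A.IsHermitian ∧
      A.charpoly = ∏ i : Fin M, (Polynomial.X - Polynomial.C (a i : ℂ)) ∧
      (A + ∑ n, Matrix.vecMulVec (φ n) (star (φ n))).charpoly
        = ∏ i : Fin M, (Polynomial.X - Polynomial.C (l i : ℂ)) ∧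
      ∀ n : Fin N, ∑ i, ‖φ n i‖ ^ 2 = u n := by
  induction N generalizing l with
  | zero =>
    have hal : ∀ i : Fin M, a i = l i := fun i => by
      have h1 := h.sum_eq
      rw [range_zero, sum_empty, add_zero] at h1
      exact (sum_eq_sum_iff_of_le fun m _ => h.le m).1 h1.symm i (mem_range.2 i.2)
    refine ⟨Matrix.diagonal fun i => (a i : ℂ), Fin.elim0, ?_, Matrix.charpoly_diagonal _, ?_,
      fun n => n.elim0⟩
    · exact Matrix.isHermitian_diagonal_of_self_adjoint _ (by ext i; simp)
    · rw [univ_eq_empty, sum_empty, add_zero, Matrix.charpoly_diagonal]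
      simp only [hal]
  | succ N ih =>
    obtain ⟨g, hg, hgl, hlg⟩ := h.exists_interlacing ha ha0 hu hu0
    obtain ⟨A, φ, hA, hAa, hC, hφ⟩ := ih hg
    obtain ⟨v, hv⟩ := (Matrix.isHermitian_add_sum_vecMulVec hA univ φ).exists_vecMulVec_charpoly
      (g := fun i => g i) (l := fun i => l i) hC (fun i => hgl i)
      fun i j hij => (h.antitone hij).trans (hlg i)
    refine ⟨A, Fin.snoc φ v, hA, hAa, ?_, fun n => ?_⟩
    · rw [Fin.sum_univ_castSucc]
      simpa only [Fin.snoc_castSucc, Fin.snoc_last, add_assoc] using hv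
    · refine Fin.lastCases ?_ (fun n => ?_) n
      · have h1 := Matrix.trace_eq_of_charpoly (a := fun i => l i) hv
        rw [Matrix.trace_add, Matrix.trace_eq_of_charpoly (a := fun i => g i) hC,
          Matrix.trace_vecMulVec_star, ← Complex.ofReal_add] at h1
        have h2 := Complex.ofReal_injective h1
        have h3 := h.sum_eq
        rw [sum_range_succ] at h3
        have h4 := hg.sum_eq
        rw [← Finset.sum_range, ← Finset.sum_range] at h2
        simp only [Fin.snoc_last, Fin.val_last]
        linarith
      · simpa only [Fin.snoc_castSucc, Fin.val_castSucc] using hφ n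

/-- `A` is unitarily diagonalised with diagonal entries `a`. -/
def HasDiagonalization {M : ℕ} (A : Matrix (Fin M) (Fin M) ℂ) (a : Fin M → ℝ) : Prop :=
  ∃ U : Matrix (Fin M) (Fin M) ℂ, U * star U = 1 ∧
    A = U * Matrix.diagonal (fun i => (a i : ℂ)) * star U

lemma Matrix.IsHermitian.hasDiagonalization {M : ℕ} {A : Matrix (Fin M) (Fin M) ℂ}
    (hA : A.IsHermitian) {a : Fin M → ℝ} {σ : Equiv.Perm (Fin M)}
    (h : ∀ i, hA.eigenvalues i = a (σ i)) : HasDiagonalization A a := by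
  set U : Matrix (Fin M) (Fin M) ℂ := hA.eigenvectorUnitary.1 with hU
  have hUU : U * star U = 1 := Unitary.coe_mul_star_self _
  have hstar : star (U.submatrix id σ.symm) = (star U).submatrix σ.symm id := by
    simp only [Matrix.star_eq_conjTranspose, Matrix.conjTranspose_submatrix]
  have hdiag : Matrix.diagonal (fun i => (a i : ℂ))
      = (Matrix.diagonal (RCLike.ofReal ∘ hA.eigenvalues)).submatrix σ.symm σ.symm := by
    rw [Matrix.submatrix_diagonal_equiv]
    congr 1
    funext i
    simp [h]
  refine ⟨U.submatrix id σ.symm, ?_, ?_⟩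
  · rw [hstar, Matrix.submatrix_mul_equiv, hUU, Matrix.submatrix_id_id]
  · rw [hstar, hdiag, Matrix.submatrix_mul_equiv, Matrix.submatrix_mul_equiv,
      Matrix.submatrix_id_id]
    conv_lhs => rw [hA.spectral_theorem, Unitary.conjStarAlgAut_apply]

lemma Matrix.IsHermitian.exists_antitone_eigenvalues {M : ℕ} {A : Matrix (Fin M) (Fin M) ℂ}
    (hA : A.IsHermitian) :
    ∃ (a : Fin M → ℝ) (σ : Equiv.Perm (Fin M)), Antitone a ∧ ∀ i, hA.eigenvalues i = a (σ i) := by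
  set f : Fin M → ℝ := fun i => -hA.eigenvalues i with hf
  refine ⟨hA.eigenvalues ∘ Tuple.sort f, (Tuple.sort f).symm, fun i j hij => ?_, fun i => by simp⟩
  simpa [hf] using Tuple.monotone_sort f hij

lemma re_star_dotProduct_self {M : ℕ} (x : Fin M → ℂ) :
    (star x ⬝ᵥ x).re = ∑ i, ‖x i‖ ^ 2 := by
  rw [dotProduct, Complex.re_sum]
  refine sum_congr rfl fun i _ => ?_
  rw [Pi.star_apply, RCLike.star_def, Complex.conj_mul']
  norm_cast

lemma sum_norm_sq_star_mulVec {M : ℕ} {U : Matrix (Fin M) (Fin M) ℂ} (hU : U * star U = 1)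
    (x : Fin M → ℂ) : ∑ i, ‖(star U).mulVec x i‖ ^ 2 = ∑ i, ‖x i‖ ^ 2 := by
  rw [← re_star_dotProduct_self, ← re_star_dotProduct_self, Matrix.star_mulVec,
    ← Matrix.dotProduct_mulVec, Matrix.mulVec_mulVec, ← Matrix.star_eq_conjTranspose, star_star,
    hU, Matrix.one_mulVec]

lemma re_quadForm_conj_diagonal {M : ℕ} (U : Matrix (Fin M) (Fin M) ℂ) (a : Fin M → ℝ)
    (x : Fin M → ℂ) :
    (star x ⬝ᵥ (U * Matrix.diagonal (fun i => (a i : ℂ)) * star U).mulVec x).re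
      = ∑ i, a i * ‖(star U).mulVec x i‖ ^ 2 := by
  have h : star x ⬝ᵥ (U * Matrix.diagonal (fun i => (a i : ℂ)) * star U).mulVec x
      = star ((star U).mulVec x) ⬝ᵥ
        (Matrix.diagonal (fun i => (a i : ℂ))).mulVec ((star U).mulVec x) := by
    rw [Matrix.star_mulVec, ← Matrix.dotProduct_mulVec, Matrix.mulVec_mulVec, Matrix.mulVec_mulVec,
      ← Matrix.star_eq_conjTranspose, star_star]
  rw [h, dotProduct, Complex.re_sum]
  refine sum_congr rfl fun i _ => ?_
  rw [Matrix.mulVec_diagonal, Pi.star_apply, RCLike.star_def, mul_left_comm, Complex.conj_mul']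
  norm_cast

/-- Weyl's inequality for a comparison of quadratic forms on a subspace cut out by `r` equations. -/
lemma HasDiagonalization.le_of_quadForm_le {M r : ℕ} {A B : Matrix (Fin M) (Fin M) ℂ}
    {a b : Fin M → ℝ} (hA : HasDiagonalization A a) (hB : HasDiagonalization B b)
    (ha : Antitone a) (hb : Antitone b) (ψ : Fin r → Fin M → ℂ)
    (hAB : ∀ x : Fin M → ℂ, (∀ n, star (ψ n) ⬝ᵥ x = 0) →
      (star x ⬝ᵥ B.mulVec x).re ≤ (star x ⬝ᵥ A.mulVec x).re)
    {i k : Fin M} (hik : (k : ℕ) = i + r) : b k ≤ a i := by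
  obtain ⟨U, hU, rfl⟩ := hA
  obtain ⟨V, hV, rfl⟩ := hB
  let F : (Fin M → ℂ) →ₗ[ℂ] ({j : Fin M // k < j} → ℂ) × ({j : Fin M // j < i} → ℂ) × (Fin r → ℂ) :=
    ((LinearMap.funLeft ℂ ℂ Subtype.val).comp (Matrix.mulVecLin (star V))).prod
      (((LinearMap.funLeft ℂ ℂ Subtype.val).comp (Matrix.mulVecLin (star U))).prod
        (Matrix.mulVecLin (Matrix.of fun n => star (ψ n))))
  have hF : LinearMap.ker F ≠ ⊥ := by
    refine LinearMap.ker_ne_bot_of_finrank_lt ?_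
    have h1 : Fintype.card {j : Fin M // k < j} = M - 1 - k := by
      rw [Fintype.card_subtype, filter_lt_eq_Ioi, Fin.card_Ioi]
    have h2 : Fintype.card {j : Fin M // j < i} = i := by
      rw [Fintype.card_subtype, filter_gt_eq_Iio, Fin.card_Iio]
    rw [Module.finrank_prod, Module.finrank_prod, Module.finrank_pi, Module.finrank_pi,
      Module.finrank_pi, Module.finrank_pi, h1, h2, Fintype.card_fin, Fintype.card_fin]
    have := k.2
    omega
  obtain ⟨x, hx, hx0⟩ := (Submodule.ne_bot_iff _).1 hF
  have hFx : F x = 0 := hx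
  have hVx : ∀ j, k < j → (star V).mulVec x j = 0 := fun j hj =>
    congrFun (congrArg Prod.fst hFx) ⟨j, hj⟩
  have hUx : ∀ j, j < i → (star U).mulVec x j = 0 := fun j hj =>
    congrFun (congrArg (fun p => p.2.1) hFx) ⟨j, hj⟩
  have hψx : ∀ n, star (ψ n) ⬝ᵥ x = 0 := fun n => congrFun (congrArg (fun p => p.2.2) hFx) n
  have hpos : 0 < ∑ j, ‖x j‖ ^ 2 := by
    obtain ⟨j, hj⟩ := Function.ne_iff.1 hx0
    exact sum_pos' (fun j _ => by positivity) ⟨j, mem_univ j, by have : x j ≠ 0 := hj; positivity⟩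
  have h := hAB x hψx
  rw [re_quadForm_conj_diagonal, re_quadForm_conj_diagonal] at h
  have hlo : b k * ∑ j, ‖x j‖ ^ 2 ≤ ∑ j, b j * ‖(star V).mulVec x j‖ ^ 2 := by
    rw [← sum_norm_sq_star_mulVec hV, mul_sum]
    refine sum_le_sum fun j _ => ?_
    rcases le_or_gt j k with hj | hj
    · exact mul_le_mul_of_nonneg_right (hb hj) (by positivity)
    · simp [hVx j hj]
  have hhi : ∑ j, a j * ‖(star U).mulVec x j‖ ^ 2 ≤ a i * ∑ j, ‖x j‖ ^ 2 := by
    rw [← sum_norm_sq_star_mulVec hU, mul_sum]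
    refine sum_le_sum fun j _ => ?_
    rcases le_or_gt i j with hj | hj
    · exact mul_le_mul_of_nonneg_right (ha hj) (by positivity)
    · simp [hUx j hj]
  exact le_of_mul_le_mul_right (hlo.trans (h.trans hhi)) hpos

lemma re_quadForm_vecMulVec {M : ℕ} (v x : Fin M → ℂ) :
    (star x ⬝ᵥ (Matrix.vecMulVec v (star v)).mulVec x).re = ‖star v ⬝ᵥ x‖ ^ 2 := by
  have h : star x ⬝ᵥ (Matrix.vecMulVec v (star v)).mulVec x
      = star (star v ⬝ᵥ x) * (star v ⬝ᵥ x) := by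
    rw [Matrix.vecMulVec_mulVec, op_smul_eq_smul, dotProduct_smul, smul_eq_mul,
      Matrix.star_dotProduct x v, mul_comm]
  rw [h, RCLike.star_def, Complex.conj_mul']
  norm_cast

lemma re_quadForm_add_sum_vecMulVec {M : ℕ} {ι : Type*} (A : Matrix (Fin M) (Fin M) ℂ)
    (s : Finset ι) (φ : ι → Fin M → ℂ) (x : Fin M → ℂ) :
    (star x ⬝ᵥ (A + ∑ n ∈ s, Matrix.vecMulVec (φ n) (star (φ n))).mulVec x).re
      = (star x ⬝ᵥ A.mulVec x).re + ∑ n ∈ s, ‖star (φ n) ⬝ᵥ x‖ ^ 2 := by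
  rw [Matrix.add_mulVec, dotProduct_add, Complex.add_re, Matrix.sum_mulVec, dotProduct_sum,
    Complex.re_sum]
  simp only [re_quadForm_vecMulVec]

lemma NonnegNonincrOn.le {M : ℕ} {a : ℕ → ℝ} (h : NonnegNonincrOn M a) {p q : ℕ} (hp : 1 ≤ p)
    (hpq : p ≤ q) (hq : q ≤ M) : a q ≤ a p := by
  induction q, hpq using Nat.le_induction with
  | base => exact le_rfl
  | succ q hpq ih => exact (h.2 q (hp.trans hpq) hq).trans (ih (by omega))

lemma NonnegNonincrOn.antitone_fin {M : ℕ} {a : ℕ → ℝ} (h : NonnegNonincrOn M a) :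
    Antitone fun i : Fin M => a (i + 1) := fun _ j hij =>
  h.le (Nat.le_add_left _ _) (Nat.succ_le_succ hij) j.2

lemma IsCompletion.excess_and_sum {M N : ℕ} {α μ lam : ℕ → ℝ} (h : IsCompletion M N α μ lam)
    (hα : NonnegNonincrOn M α) :
    (∀ j ≤ N, ∑ m ∈ Ico j M, max (lam (m + 1) - α (m - j + 1)) 0 ≤ ∑ n ∈ Ico j N, μ (n + 1)) ∧
    ∑ m ∈ range M, lam (m + 1) = ∑ m ∈ range M, α (m + 1) + ∑ n ∈ range N, μ (n + 1) := by
  obtain ⟨hlam, A, hA, φ, hB, σ, τ, hσ, hφ, hτ⟩ := h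
  have htrφ : ∀ s : Finset (Fin N), (∑ n ∈ s, Matrix.vecMulVec (φ n) (star (φ n))).trace
      = ((∑ n ∈ s, μ (n + 1) : ℝ) : ℂ) := fun s => by
    rw [Matrix.trace_sum, Complex.ofReal_sum]
    exact sum_congr rfl fun n _ => by rw [Matrix.trace_vecMulVec_star, hφ]
  have htr : ∀ {C : Matrix (Fin M) (Fin M) ℂ} (hC : C.IsHermitian) {c : Fin M → ℝ}
      {ρ : Equiv.Perm (Fin M)}, (∀ i, hC.eigenvalues i = c (ρ i)) →
      C.trace = ((∑ i, c i : ℝ) : ℂ) := by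
    intro C hC c ρ hρ
    rw [hC.trace_eq_sum_eigenvalues, ← Equiv.sum_comp ρ c, Complex.ofReal_sum]
    exact sum_congr rfl fun i _ => by rw [hρ]; rfl
  have hBtr := htr hB (c := fun i => lam (i + 1)) hτ
  refine ⟨fun j hj => ?_, ?_⟩
  · set s : Finset (Fin N) := univ.filter fun n => (n : ℕ) < j with hs
    set s' : Finset (Fin N) := univ.filter fun n => ¬ (n : ℕ) < j with hs'
    have hC := Matrix.isHermitian_add_sum_vecMulVec hA s φ
    set C := A + ∑ n ∈ s, Matrix.vecMulVec (φ n) (star (φ n)) with hCdef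
    have hBC : A + ∑ n, Matrix.vecMulVec (φ n) (star (φ n))
        = C + ∑ n ∈ s', Matrix.vecMulVec (φ n) (star (φ n)) := by
      rw [hCdef, add_assoc, hs, hs', sum_filter_add_sum_filter_not]
    obtain ⟨c, ρ, hc, hρ⟩ := hC.exists_antitone_eigenvalues
    have hAd := hA.hasDiagonalization (a := fun i => α (i + 1)) hσ
    have hBd := hB.hasDiagonalization (a := fun i => lam (i + 1)) hτ
    have hCd := hC.hasDiagonalization hρ
    have hcl : ∀ i, c i ≤ lam (i + 1) := fun i => by
      refine hBd.le_of_quadForm_le (r := 0) hCd hlam.antitone_fin hc Fin.elim0 (fun x _ => ?_) rfl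
      rw [hBC, re_quadForm_add_sum_vecMulVec C]
      exact le_add_of_nonneg_right (sum_nonneg fun n _ => by positivity)
    have hcα : ∀ i k : Fin M, (k : ℕ) = i + j → c k ≤ α (i + 1) := fun i k hik => by
      refine hAd.le_of_quadForm_le hCd hα.antitone_fin hc
        (fun n : Fin j => φ (Fin.castLE hj n)) (fun x hx => ?_) hik
      rw [hCdef, re_quadForm_add_sum_vecMulVec, sum_eq_zero, add_zero]
      intro n hn
      have := hx ⟨n, (mem_filter.1 hn).2⟩
      rw [show Fin.castLE hj ⟨n, (mem_filter.1 hn).2⟩ = n from rfl] at this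
      simp [this]
    have hsum : ∑ i : Fin M, lam (i + 1) - ∑ i, c i = ∑ n ∈ Ico j N, μ (n + 1) := by
      rw [hBC, Matrix.trace_add, htr hC hρ, htrφ, ← Complex.ofReal_add] at hBtr
      rw [← Complex.ofReal_injective hBtr, add_sub_cancel_left, hs', sum_filter,
        ← Finset.sum_range (fun n => if ¬ n < j then μ (n + 1) else 0), ← sum_filter]
      refine sum_congr ?_ fun _ _ => rfl
      ext n
      simp only [mem_filter, mem_range, mem_Ico]
      omega
    set d : ℕ → ℝ := fun m => if hm : m < M then lam (m + 1) - c ⟨m, hm⟩ else 0 with hd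
    have hd0 : ∀ m, 0 ≤ d m := fun m => by
      simp only [hd]
      split_ifs with hm
      exacts [sub_nonneg.2 (hcl ⟨m, hm⟩), le_rfl]
    have hdsum : ∑ m ∈ range M, d m = ∑ n ∈ Ico j N, μ (n + 1) := by
      rw [← hsum, ← sum_sub_distrib, Finset.sum_range]
      simp [hd]
    rw [← hdsum]
    refine (sum_le_sum fun m hm => ?_).trans
      (sum_le_sum_of_subset_of_nonneg (fun m hm => mem_range.2 (mem_Ico.1 hm).2) fun m _ _ => hd0 m)
    obtain ⟨hjm, hmM⟩ := mem_Ico.1 hm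
    refine max_le ?_ (hd0 m)
    simp only [hd, dif_pos hmM]
    have := hcα ⟨m - j, by omega⟩ ⟨m, hmM⟩ (by simp only; omega)
    simp only at this
    linarith
  · rw [Matrix.trace_add, htr hA (c := fun i => α (i + 1)) hσ, htrφ, ← Complex.ofReal_add] at hBtr
    have := Complex.ofReal_injective hBtr
    rw [Finset.sum_range, Finset.sum_range, Finset.sum_range]
    exact this.symm

/-- Total excess over the copy of `α` shifted by `j` of the sequence that equals `t` up to index
`k` and `β` afterwards, from index `j` on. -/
noncomputable def levelExcess (M : ℕ) (α β : ℕ → ℝ) (k j : ℕ) (t : ℝ) : ℝ :=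
  ∑ m ∈ Ico j (k + 1), max (t - α (m - j + 1)) 0
    + ∑ m ∈ Ico (k + 1) (M + 1), max (β m - α (m - j + 1)) 0

lemma continuous_levelExcess (M : ℕ) (α β : ℕ → ℝ) (k j : ℕ) :
    Continuous (levelExcess M α β k j) := by
  unfold levelExcess
  fun_prop

lemma levelExcess_mono (M : ℕ) (α β : ℕ → ℝ) (k j : ℕ) : Monotone (levelExcess M α β k j) :=
  fun s t hst => by
    unfold levelExcess
    gcongr

lemma levelExcess_succ {M : ℕ} (α β : ℕ → ℝ) {k j : ℕ} (hj : j ≤ k + 1) (hk : k < M) :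
    levelExcess M α β (k + 1) j (β (k + 1)) = levelExcess M α β k j (β (k + 1)) := by
  unfold levelExcess
  rw [sum_Ico_succ_top hj, sum_eq_sum_Ico_succ_bot (show k + 1 < M + 1 by omega), add_assoc]

lemma levelExcess_of_le {M : ℕ} {α : ℕ → ℝ} (hα : NonnegNonincrOn M α) (β : ℕ → ℝ) {k j : ℕ}
    (hj : 1 ≤ j) (hk : k ≤ M) {t : ℝ} (ht : t ≤ α (k - j + 1)) :
    levelExcess M α β k j t = ∑ m ∈ Ico (k + 1) (M + 1), max (β m - α (m - j + 1)) 0 := by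
  unfold levelExcess
  rw [sum_eq_zero, zero_add]
  intro m hm
  have hm' := mem_Ico.1 hm
  have := hα.le (p := m - j + 1) (q := k - j + 1) (by omega) (by omega) (by omega)
  exact max_eq_right (by linarith)

/-- Each `β k` is the largest level compatible with the later ones. -/
structure IsGreedy (M N : ℕ) (α μ β : ℕ → ℝ) : Prop where
  feasible : ∀ k, 1 ≤ k → k ≤ M → ∀ j, 1 ≤ j → j ≤ k →
    levelExcess M α β k j (β k) ≤ ∑ n ∈ Ico j (N + 1), μ n
  le_of_feasible : ∀ k, 1 ≤ k → k ≤ M → ∀ t, (∀ j, 1 ≤ j → j ≤ k →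
    levelExcess M α β k j t ≤ ∑ n ∈ Ico j (N + 1), μ n) → t ≤ β k

lemma NonnegNonincrOn.tail_nonneg {N : ℕ} {μ : ℕ → ℝ} (hμ : NonnegNonincrOn N μ) {j : ℕ}
    (hj : 1 ≤ j) : 0 ≤ ∑ n ∈ Ico j (N + 1), μ n :=
  sum_nonneg fun n hn => hμ.1 n (hj.trans (mem_Ico.1 hn).1) (Nat.lt_succ_iff.1 (mem_Ico.1 hn).2)

lemma feasible_set_properties {M : ℕ} {α β : ℕ → ℝ} (hα : NonnegNonincrOn M α) {k : ℕ}
    (hk1 : 1 ≤ k) (hk : k ≤ M) {T : ℕ → ℝ}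
    (hR : ∀ j, 1 ≤ j → j ≤ k → ∑ m ∈ Ico (k + 1) (M + 1), max (β m - α (m - j + 1)) 0 ≤ T j)
    {S : Set ℝ} (hS : S = {t | ∀ j, 1 ≤ j → j ≤ k → levelExcess M α β k j t ≤ T j}) :
    S.Nonempty ∧ BddAbove S ∧ sSup S ∈ S := by
  have hne : S.Nonempty := by
    refine ⟨0, ?_⟩
    rw [hS]
    intro j hj hjk
    rw [levelExcess_of_le hα β hj hk (hα.1 _ (by omega) (by omega))]
    exact hR j hj hjk
  have hbdd : BddAbove S := by
    refine ⟨α 1 + T k, fun t ht => ?_⟩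
    rw [hS] at ht
    have h1 := ht k hk1 le_rfl
    unfold levelExcess at h1
    rw [Nat.Ico_succ_singleton, sum_singleton, Nat.sub_self, zero_add] at h1
    have h2 : 0 ≤ ∑ m ∈ Ico (k + 1) (M + 1), max (β m - α (m - k + 1)) 0 :=
      sum_nonneg fun m _ => le_max_right _ _
    linarith [le_max_left (t - α 1) 0]
  have hclosed : IsClosed S := by
    rw [hS]
    simp only [Set.ofPred_forall]
    exact isClosed_iInter fun j => isClosed_iInter fun _ => isClosed_iInter fun _ =>
      isClosed_le (continuous_levelExcess M α β k j) continuous_const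
  exact ⟨hne, hbdd, hclosed.csSup_mem hne hbdd⟩

/-- The feasible sets have maxima, which determine a greedy sequence. -/
lemma isGreedy_of_eq_sSup {M N : ℕ} {α μ β : ℕ → ℝ} (hα : NonnegNonincrOn M α)
    (hμ : NonnegNonincrOn N μ) {S : ℕ → Set ℝ}
    (hS : ∀ k, S k = {t | ∀ j, 1 ≤ j → j ≤ k →
      levelExcess M α β k j t ≤ ∑ n ∈ Ico j (N + 1), μ n})
    (hβ : ∀ k, 1 ≤ k → k ≤ M → β k = sSup (S k)) :
    (∀ k, 1 ≤ k → k ≤ M → (S k).Nonempty ∧ BddAbove (S k) ∧ sSup (S k) ∈ S k) ∧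
      IsGreedy M N α μ β := by
  have hR : ∀ k ≤ M, ∀ j, 1 ≤ j → j ≤ k →
      ∑ m ∈ Ico (k + 1) (M + 1), max (β m - α (m - j + 1)) 0 ≤ ∑ n ∈ Ico j (N + 1), μ n := by
    intro k hk
    induction hk using Nat.decreasingInduction with
    | self =>
      intro j hj _
      rw [Ico_self, sum_empty]
      exact hμ.tail_nonneg hj
    | of_succ k hk ih =>
      intro j hj hjk
      have h1 := (feasible_set_properties hα (by omega) hk ih (hS (k + 1))).2.2
      rw [← hβ (k + 1) (by omega) hk, hS] at h1
      have h2 := h1 j hj (by omega)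
      rw [levelExcess_succ α β (by omega) hk] at h2
      refine le_trans ?_ h2
      exact le_add_of_nonneg_left (sum_nonneg fun m _ => le_max_right _ _)
  have hprop := fun k hk1 hk => feasible_set_properties hα hk1 hk (hR k hk) (hS k)
  refine ⟨hprop, fun k hk1 hk => ?_, fun k hk1 hk t ht => ?_⟩
  · have h1 := (hprop k hk1 hk).2.2
    rwa [← hβ k hk1 hk, hS] at h1
  · rw [hβ k hk1 hk]
    refine le_csSup (hprop k hk1 hk).2.1 ?_
    rw [hS]
    exact ht

namespace IsGreedy

variable {M N : ℕ} {α μ β : ℕ → ℝ}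

lemma succ_le (h : IsGreedy M N α μ β) {k : ℕ} (hk1 : 1 ≤ k) (hk : k < M) : β (k + 1) ≤ β k :=
  h.le_of_feasible k hk1 hk.le _ fun j hj hjk => by
    rw [← levelExcess_succ α β (by omega) hk]
    exact h.feasible (k + 1) (by omega) hk j hj (by omega)

lemma le_self (h : IsGreedy M N α μ β) (hα : NonnegNonincrOn M α) {k : ℕ} (hk1 : 1 ≤ k)
    (hk : k ≤ M) : α k ≤ β k :=
  h.le_of_feasible k hk1 hk _ fun j hj hjk => by
    rw [levelExcess_of_le hα β hj hk (hα.le (by omega) (by omega) hk)]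
    refine le_trans ?_ (h.feasible k hk1 hk j hj hjk)
    exact le_add_of_nonneg_left (sum_nonneg fun m _ => le_max_right _ _)

lemma nonnegNonincrOn (h : IsGreedy M N α μ β) (hα : NonnegNonincrOn M α) :
    NonnegNonincrOn M β :=
  ⟨fun _ hm1 hm => (hα.1 _ hm1 hm).trans (h.le_self hα hm1 hm), fun _ => h.succ_le⟩

lemma excess (h : IsGreedy M N α μ β) {j : ℕ} (hj1 : 1 ≤ j) (hj : j ≤ M) :
    ∑ m ∈ Ico j (M + 1), max (β m - α (m - j + 1)) 0 ≤ ∑ n ∈ Ico j (N + 1), μ n := by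
  have h1 := h.feasible j hj1 hj j hj1 le_rfl
  unfold levelExcess at h1
  rw [Nat.Ico_succ_singleton, sum_singleton] at h1
  rwa [sum_eq_sum_Ico_succ_bot (Nat.lt_succ_iff.2 hj)]

lemma sum_eq (h : IsGreedy M N α μ β) (hα : NonnegNonincrOn M α) (hM : 0 < M) :
    ∑ m ∈ Ico 1 (M + 1), β m = ∑ m ∈ Ico 1 (M + 1), α m + ∑ n ∈ Ico 1 (N + 1), μ n := by
  have hpos : ∀ i, 1 ≤ i → ∑ m ∈ Ico i (M + 1), max (β m - α (m - 1 + 1)) 0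
      = ∑ m ∈ Ico i (M + 1), (β m - α m) := fun i hi =>
    sum_congr rfl fun m hm => by
      have hm' := mem_Ico.1 hm
      rw [Nat.sub_add_cancel (by omega)]
      exact max_eq_left (sub_nonneg.2 (h.le_self hα (by omega) (by omega)))
  have h1 := h.excess le_rfl hM
  rw [hpos 1 le_rfl, sum_sub_distrib] at h1
  set t := α 1 + (∑ n ∈ Ico 1 (N + 1), μ n - ∑ m ∈ Ico 2 (M + 1), (β m - α m)) with ht
  have hbot : ∑ m ∈ Ico 1 (M + 1), (β m - α m) = β 1 - α 1 + ∑ m ∈ Ico 2 (M + 1), (β m - α m) :=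
    sum_eq_sum_Ico_succ_bot (by omega) _
  have hle := h.le_self hα le_rfl hM
  rw [sum_sub_distrib] at hbot
  have h2 : t ≤ β 1 := by
    refine h.le_of_feasible 1 le_rfl hM t fun j hj hj1 => ?_
    obtain rfl : j = 1 := by omega
    unfold levelExcess
    rw [Nat.Ico_succ_singleton, sum_singleton, Nat.sub_self, zero_add, hpos 2 (by omega),
      max_eq_left (by linarith)]
    linarith
  linarith

lemma levelExcess_antitone (h : IsGreedy M N α μ β) {j k p : ℕ} (hj : 1 ≤ j) (hjk : j ≤ k)
    (hkp : k ≤ p) (hp : p ≤ M) : levelExcess M α β p j (β p) ≤ levelExcess M α β k j (β k) := by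
  induction p, hkp using Nat.le_induction with
  | base => exact le_rfl
  | succ p hkp ih =>
    refine le_trans ?_ (ih (by omega))
    rw [levelExcess_succ α β (by omega) hp]
    exact levelExcess_mono M α β p j (h.succ_le (by omega) hp)

lemma exists_tight (h : IsGreedy M N α μ β) (hα : NonnegNonincrOn M α) {k : ℕ} (hk1 : 1 ≤ k)
    (hk : k ≤ M) : ∃ j, 1 ≤ j ∧ j ≤ k ∧
      ∑ n ∈ Ico j (N + 1), μ n ≤ levelExcess M α β k j (β k) ∧ α (k - j + 1) ≤ β k := by
  by_contra! hcon
  have hev : ∀ᶠ t in nhdsWithin (β k) (Set.Ioi (β k)), ∀ j ∈ Icc 1 k,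
      levelExcess M α β k j t ≤ ∑ n ∈ Ico j (N + 1), μ n := by
    rw [Filter.eventually_all_finset]
    intro j hj
    obtain ⟨hj1, hjk⟩ := mem_Icc.1 hj
    refine Filter.Eventually.filter_mono nhdsWithin_le_nhds ?_
    by_cases hlt : levelExcess M α β k j (β k) < ∑ n ∈ Ico j (N + 1), μ n
    · exact ((continuous_levelExcess M α β k j).continuousAt.eventually_lt
        continuousAt_const hlt).mono fun t ht => ht.le
    · filter_upwards [eventually_lt_nhds (hcon j hj1 hjk (not_lt.1 hlt))] with t ht
      rw [levelExcess_of_le hα β hj1 hk ht.le]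
      refine le_trans ?_ (h.feasible k hk1 hk j hj1 hjk)
      exact le_add_of_nonneg_left (sum_nonneg fun m _ => le_max_right _ _)
  obtain ⟨t, ht, htk⟩ := (hev.and self_mem_nhdsWithin).exists
  exact absurd (h.le_of_feasible k hk1 hk t fun j hj hjk => ht j (mem_Icc.2 ⟨hj, hjk⟩))
    (not_le.2 htk)

lemma exists_tight_dominating (h : IsGreedy M N α μ β) (hα : NonnegNonincrOn M α) {k : ℕ}
    (hk1 : 1 ≤ k) (hk : k ≤ M) : ∃ j, 1 ≤ j ∧ j ≤ k ∧
      ∑ n ∈ Ico j (N + 1), μ n ≤ levelExcess M α β k j (β k) ∧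
      ∀ m, k ≤ m → m ≤ M → α (m - j + 1) ≤ β m := by
  classical
  have hex := h.exists_tight hα hk1 hk
  obtain ⟨hj1, hjk, htight, hαβ⟩ := Nat.find_spec hex
  refine ⟨Nat.find hex, hj1, hjk, htight, fun p hkp hp => ?_⟩
  by_contra! hlt
  obtain ⟨i, hi1, hip, hi, hiβ⟩ := h.exists_tight hα (hk1.trans hkp) hp
  have hij : i < Nat.find hex := by
    by_contra! hji
    have := hα.le (p := p - i + 1) (q := p - Nat.find hex + 1) (by omega) (by omega) (by omega)
    linarith
  refine Nat.find_min hex hij ⟨hi1, by omega,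
    hi.trans (h.levelExcess_antitone hi1 (by omega) hkp hp), ?_⟩
  exact (hα.le (by omega) (by omega) (by omega)).trans hαβ

lemma tail_sum_le (h : IsGreedy M N α μ β) (hα : NonnegNonincrOn M α) {lam : ℕ → ℝ}
    (hlam : NonnegNonincrOn M lam)
    (hE : ∀ j, 1 ≤ j → j ≤ M →
      ∑ m ∈ Ico j (M + 1), max (lam m - α (m - j + 1)) 0 ≤ ∑ n ∈ Ico j (N + 1), μ n)
    {k : ℕ} (hk1 : 1 ≤ k) (hk : k ≤ M + 1) :
    ∑ m ∈ Ico k (M + 1), lam m ≤ ∑ m ∈ Ico k (M + 1), β m := by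
  induction hk using Nat.decreasingInduction with
  | self => simp
  | of_succ k hk ih =>
    by_contra! hlt
    have ih := ih (by omega)
    have hl := sum_eq_sum_Ico_succ_bot hk lam
    have hb := sum_eq_sum_Ico_succ_bot hk β
    have hkk : β k < lam k := by linarith
    obtain ⟨j, hj1, hjk, htight, hdom⟩ := h.exists_tight_dominating hα hk1 (by omega)
    have hβE : levelExcess M α β k j (β k) = ∑ m ∈ Ico j k, max (β k - α (m - j + 1)) 0
        + (∑ m ∈ Ico k (M + 1), β m - ∑ m ∈ Ico k (M + 1), α (m - j + 1)) := by
      rw [← sum_sub_distrib]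
      unfold levelExcess
      rw [sum_Ico_succ_top hjk, add_assoc, ← sum_eq_sum_Ico_succ_bot hk
        (fun m => max (β m - α (m - j + 1)) 0)]
      congr 1
      refine sum_congr rfl fun m hm => max_eq_left (sub_nonneg.2 ?_)
      have hm' := mem_Ico.1 hm
      exact hdom m hm'.1 (by omega)
    have hhead : ∑ m ∈ Ico j k, max (β k - α (m - j + 1)) 0
        ≤ ∑ m ∈ Ico j k, max (lam m - α (m - j + 1)) 0 := by
      refine sum_le_sum fun m hm => max_le_max_right _ ?_
      have hm' := mem_Ico.1 hm
      linarith [hlam.le (p := m) (q := k) (by omega) (by omega) (by omega)]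
    have htail : ∑ m ∈ Ico k (M + 1), lam m - ∑ m ∈ Ico k (M + 1), α (m - j + 1)
        ≤ ∑ m ∈ Ico k (M + 1), max (lam m - α (m - j + 1)) 0 := by
      rw [← sum_sub_distrib]
      exact sum_le_sum fun m _ => le_max_left _ _
    have hEj := hE j hj1 (by omega)
    rw [← sum_Ico_consecutive _ hjk (by omega : k ≤ M + 1)] at hEj
    linarith

end IsGreedy

/-- The zero-based version of `a 1, …, a M`, continued by zero. -/
def zeroExtend (M : ℕ) (a : ℕ → ℝ) (m : ℕ) : ℝ := if m < M then a (m + 1) else 0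

lemma zeroExtend_of_lt {M m : ℕ} (a : ℕ → ℝ) (hm : m < M) : zeroExtend M a m = a (m + 1) :=
  if_pos hm

lemma zeroExtend_of_le {M m : ℕ} (a : ℕ → ℝ) (hm : M ≤ m) : zeroExtend M a m = 0 :=
  if_neg (not_lt.2 hm)

lemma sum_Ico_zeroExtend (M : ℕ) (a : ℕ → ℝ) (j : ℕ) :
    ∑ m ∈ Ico j M, zeroExtend M a m = ∑ m ∈ Ico (j + 1) (M + 1), a m := by
  rw [← sum_Ico_add']
  exact sum_congr rfl fun m hm => zeroExtend_of_lt a (mem_Ico.1 hm).2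

namespace NonnegNonincrOn

variable {M : ℕ} {a : ℕ → ℝ}

lemma zeroExtend_nonneg (h : NonnegNonincrOn M a) (m : ℕ) : 0 ≤ zeroExtend M a m := by
  unfold zeroExtend
  split_ifs with hm
  exacts [h.1 _ (by omega) hm, le_rfl]

lemma antitone_zeroExtend (h : NonnegNonincrOn M a) : Antitone (zeroExtend M a) := by
  intro p q hpq
  rcases lt_or_ge q M with hq | hq
  · rw [zeroExtend_of_lt a hq, zeroExtend_of_lt a (hpq.trans_lt hq)]
    exact h.le (by omega) (by omega) hq
  · rw [zeroExtend_of_le a hq]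
    exact h.zeroExtend_nonneg p

end NonnegNonincrOn

namespace IsGreedy

variable {M N : ℕ} {α μ β : ℕ → ℝ}

lemma attainable (h : IsGreedy M N α μ β) (hα : NonnegNonincrOn M α) (hμ : NonnegNonincrOn N μ)
    (hM : 0 < M) :
    Attainable M N (zeroExtend M α) (zeroExtend N μ) (zeroExtend M β) where
  antitone := (h.nonnegNonincrOn hα).antitone_zeroExtend
  eq_zero _ hm := zeroExtend_of_le β hm
  le m := by
    rcases lt_or_ge m M with hm | hm
    · rw [zeroExtend_of_lt α hm, zeroExtend_of_lt β hm]
      exact h.le_self hα (by omega) hm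
    · rw [zeroExtend_of_le α hm, zeroExtend_of_le β hm]
  sum_eq := by
    simp only [range_eq_Ico, sum_Ico_zeroExtend]
    exact h.sum_eq hα hM
  excess j := by
    rw [sum_Ico_zeroExtend]
    rcases lt_or_ge j M with hj | hj
    · refine le_of_eq_of_le ?_ (h.excess (j := j + 1) (by omega) hj)
      rw [← sum_Ico_add']
      refine sum_congr rfl fun m hm => ?_
      have hm' := mem_Ico.1 hm
      rw [zeroExtend_of_lt β hm'.2, zeroExtend_of_lt α (by omega), Nat.add_sub_add_right]
    · rw [Ico_eq_empty_of_le hj, sum_empty]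
      exact hμ.tail_nonneg (by omega)

lemma isCompletion (h : IsGreedy M N α μ β) (hα : NonnegNonincrOn M α)
    (hμ : NonnegNonincrOn N μ) (hM : 0 < M) : IsCompletion M N α μ β := by
  obtain ⟨A, φ, hA, hAc, hBc, hφ⟩ := (h.attainable hα hμ hM).exists_matrix
    hα.antitone_zeroExtend hα.zeroExtend_nonneg hμ.antitone_zeroExtend hμ.zeroExtend_nonneg
  have hB := Matrix.isHermitian_add_sum_vecMulVec hA univ φ
  obtain ⟨σ, hσ⟩ := hA.exists_perm_eigenvalues hAc
  obtain ⟨τ, hτ⟩ := hB.exists_perm_eigenvalues hBc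
  exact ⟨h.nonnegNonincrOn hα, A, hA, φ, hB, σ, τ,
    fun i => (hσ i).trans (zeroExtend_of_lt α (σ i).2),
    fun n => (hφ n).trans (zeroExtend_of_lt μ n.2),
    fun i => (hτ i).trans (zeroExtend_of_lt β (τ i).2)⟩

lemma sum_eq_of_isCompletion (h : IsGreedy M N α μ β) (hα : NonnegNonincrOn M α) (hM : 0 < M)
    {lam : ℕ → ℝ} (hlam : IsCompletion M N α μ lam) :
    ∑ m ∈ Ico 1 (M + 1), β m = ∑ m ∈ Ico 1 (M + 1), lam m := by
  have hsum := (hlam.excess_and_sum hα).2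
  simp only [range_eq_Ico] at hsum
  rw [sum_Ico_add' lam, sum_Ico_add' α, sum_Ico_add' μ] at hsum
  exact (h.sum_eq hα hM).trans hsum.symm

lemma sum_le_of_isCompletion (h : IsGreedy M N α μ β) (hα : NonnegNonincrOn M α) (hM : 0 < M)
    (hMN : M ≤ N) {lam : ℕ → ℝ} (hlam : IsCompletion M N α μ lam) {j : ℕ} (hj : j ≤ M) :
    ∑ m ∈ Ico 1 (j + 1), β m ≤ ∑ m ∈ Ico 1 (j + 1), lam m := by
  have htail := h.tail_sum_le hα hlam.1 (k := j + 1) (fun i hi hiM => by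
    obtain ⟨i, rfl⟩ := Nat.exists_eq_add_of_le' hi
    refine le_of_eq_of_le ?_
      (((hlam.excess_and_sum hα).1 i (by omega)).trans_eq (sum_Ico_add' μ i N 1))
    rw [← sum_Ico_add']
    exact sum_congr rfl fun m _ => by rw [Nat.add_sub_add_right]) (by omega) (by omega)
  have htotal := h.sum_eq_of_isCompletion hα hM hlam
  rw [← sum_Ico_consecutive β (show 1 ≤ j + 1 by omega) (show j + 1 ≤ M + 1 by omega),
    ← sum_Ico_consecutive lam (show 1 ≤ j + 1 by omega) (show j + 1 ≤ M + 1 by omega)] at htotal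
  linarith

end IsGreedy

/-- The recursively defined sequence `β` (with `β k` the supremum of the feasible set
`S k`, which depends only on `β (k+1), …, β M`) is well-defined (each `S k` is nonempty,
bounded above, and contains its supremum), is an `(α,μ)`-completion, and is minimal with
respect to majorization among all `(α,μ)`-completions. -/
theorem optimal_completion (M N : ℕ) (hM : 0 < M) (hMN : M ≤ N) (α μ : ℕ → ℝ)
    (hα : NonnegNonincrOn M α) (hμ : NonnegNonincrOn N μ)
    (β : ℕ → ℝ) (S : ℕ → Set ℝ)
    (hS : ∀ k, S k = {t : ℝ | ∀ j, 1 ≤ j → j ≤ k →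
      ∑ m ∈ Icc j k, max (t - α (m - j + 1)) 0
        + ∑ m ∈ Icc (k + 1) M, max (β m - α (m - j + 1)) 0
      ≤ ∑ n ∈ Icc j N, μ n})
    (hβ : ∀ k, 1 ≤ k → k ≤ M → β k = sSup (S k)) :
    (∀ k, 1 ≤ k → k ≤ M → (S k).Nonempty ∧ BddAbove (S k) ∧ sSup (S k) ∈ S k) ∧
    IsCompletion M N α μ β ∧
    ∀ lam : ℕ → ℝ, IsCompletion M N α μ lam →
      (∀ j, 1 ≤ j → j ≤ M → ∑ m ∈ Icc 1 j, β m ≤ ∑ m ∈ Icc 1 j, lam m) ∧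
      ∑ m ∈ Icc 1 M, β m = ∑ m ∈ Icc 1 M, lam m := by
  simp only [← Ico_add_one_right_eq_Icc] at hS ⊢
  obtain ⟨hmax, hG⟩ := isGreedy_of_eq_sSup hα hμ hS hβ
  exact ⟨hmax, hG.isCompletion hα hμ hM, fun lam hlam =>
    ⟨fun j _ hj => hG.sum_le_of_isCompletion hα hM hMN hlam hj,
      hG.sum_eq_of_isCompletion hα hM hlam⟩⟩
end

section
/- Let α = (α_1,…,α_M) and μ = (μ_1,…,μ_N) be nonnegative nonincreasing real sequences with M ≤ N, and let β = (β_1,…,β_M) satisfy β_k = sup S_k for all k = 1,…,M, where S_k := {t ∈ ℝ : f_{k;j}(t) ≤ ν_j for all j = 1,…,k}. For k = 1,…,M let J(k) := {j ∈ {1,…,k} : the preimage f_{k;j}^{-1}((−∞, ν_j]) equals (−∞, β_k]}. Then for every k, J(k) is nonempty and f_{k;j}(β_k) = ν_j for every j ∈ J(k). -/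
open Finset

/-- If the sublevel set at level `c` of a continuous function is `(-∞, b]`, the function attains
the value `c` at `b`. -/
theorem Continuous.eq_of_sublevel_eq_Iic {g : ℝ → ℝ} (hg : Continuous g) {b c : ℝ}
    (h : {t : ℝ | g t ≤ c} = Set.Iic b) : g b = c := by
  have hb : b ∈ {t : ℝ | g t ≤ c} := h ▸ Set.self_mem_Iic
  refine le_antisymm hb (ge_of_tendsto (hg.continuousWithinAt (s := Set.Ioi b)) ?_)
  filter_upwards [self_mem_nhdsWithin] with t ht
  by_contra! hlt
  have : t ∈ Set.Iic b := h ▸ (show t ∈ {t : ℝ | g t ≤ c} from hlt.le)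
  exact not_lt_of_ge (Set.mem_Iic.1 this) (Set.mem_Ioi.1 ht)

/-- If `b` is the greatest point satisfying finitely many monotone constraints `g j t ≤ c j`, then
one of the constraints alone already cuts out `(-∞, b]`. -/
theorem exists_sublevel_eq_Iic_of_isGreatest {ι : Type*} {s : Finset ι} (hs : s.Nonempty)
    {g : ι → ℝ → ℝ} (hg : ∀ j, Monotone (g j)) {c : ι → ℝ} {b : ℝ}
    (hb : IsGreatest {t : ℝ | ∀ j ∈ s, g j t ≤ c j} b) :
    ∃ j ∈ s, {t : ℝ | g j t ≤ c j} = Set.Iic b := by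
  by_contra! h
  have hex : ∀ j, ∃ t, j ∈ s → b < t ∧ g j t ≤ c j := by
    intro j
    by_cases hj : j ∈ s
    · by_contra! hne
      refine h j hj (Set.Subset.antisymm (fun t ht => ?_)
        fun t ht => (hg j ht).trans (hb.1 j hj))
      by_contra hlt
      exact not_lt_of_ge ht ((hne t).2 (not_le.1 hlt))
    · exact ⟨0, fun hj' => absurd hj' hj⟩
  choose t ht using hex
  have hmem : s.inf' hs t ∈ {t : ℝ | ∀ j ∈ s, g j t ≤ c j} := fun j hj =>
    (hg j (Finset.inf'_le t hj)).trans (ht j hj).2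
  exact not_lt_of_ge (hb.2 hmem) ((Finset.lt_inf'_iff hs).2 fun j hj => (ht j hj).1)

/-- For each `k`, the set `J k` of indices `j ∈ {1, …, k}` whose constraint is active at
`β k` (i.e. `{t : f k j t ≤ ν j} = (-∞, β k]`) is nonempty, and `f k j (β k) = ν j` for
every `j ∈ J k`. -/
theorem active_constraints (M N : ℕ) (hM : 0 < M) (hMN : M ≤ N)
    (α μ : ℕ → ℝ) (hα : NonnegNonincrOn M α) (hμ : NonnegNonincrOn N μ)
    (β : ℕ → ℝ) (f : ℕ → ℕ → ℝ → ℝ)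
    (hf : ∀ k j (t : ℝ), f k j t =
      ∑ m ∈ Icc j k, max (t - α (m - j + 1)) 0
        + ∑ m ∈ Icc (k + 1) M, max (β m - α (m - j + 1)) 0)
    (ν : ℕ → ℝ) (hν : ∀ j, ν j = ∑ n ∈ Icc j N, μ n)
    (S : ℕ → Set ℝ)
    (hS : ∀ k, S k = {t : ℝ | ∀ j, 1 ≤ j → j ≤ k → f k j t ≤ ν j})
    (hβ : ∀ k, 1 ≤ k → k ≤ M → β k = sSup (S k))
    :
    ∀ k, 1 ≤ k → k ≤ M →
      (∃ j, 1 ≤ j ∧ j ≤ k ∧ {t : ℝ | f k j t ≤ ν j} = Set.Iic (β k)) ∧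
      ∀ j, 1 ≤ j → j ≤ k → {t : ℝ | f k j t ≤ ν j} = Set.Iic (β k) →
        f k j (β k) = ν j := by
  have hcont : ∀ k j, Continuous (f k j) := fun k j => by
    rw [funext (hf k j)]
    fun_prop
  have hmono : ∀ k j, Monotone (f k j) := fun k j x y hxy => by
    rw [hf, hf]
    gcongr
  have hclosed : ∀ k, IsClosed (S k) := fun k => by
    rw [hS]
    simp only [Set.ofPred_forall]
    exact isClosed_iInter fun j => isClosed_iInter fun _ => isClosed_iInter fun _ =>
      isClosed_le (hcont k j) continuous_const
  have hbdd : ∀ k, 1 ≤ k → BddAbove (S k) := fun k hk => by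
    refine ⟨ν k + α 1, fun t ht => ?_⟩
    rw [hS] at ht
    have h := ht k hk le_rfl
    rw [hf, Icc_self, sum_singleton, Nat.sub_self, zero_add] at h
    have hnonneg : 0 ≤ ∑ m ∈ Icc (k + 1) M, max (β m - α (m - k + 1)) 0 :=
      sum_nonneg fun _ _ => le_max_right _ _
    linarith [le_max_left (t - α 1) 0]
  -- At `t = 0` only the tail sums over `m > k` survive.
  have hzero : ∀ k j, 1 ≤ j → k ≤ M →
      f k j 0 = ∑ m ∈ Icc (k + 1) M, max (β m - α (m - j + 1)) 0 := fun k j hj hk => by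
    rw [hf, sum_eq_zero, zero_add]
    intro m hm
    rw [mem_Icc] at hm
    exact max_eq_right (by linarith [hα.1 (m - j + 1) (by omega) (by omega)])
  have hmem_of_zero : ∀ k, 1 ≤ k → k ≤ M → 0 ∈ S k → β k ∈ S k := fun k hk hkM h0 => by
    rw [hβ k hk hkM]
    exact (hclosed k).csSup_mem ⟨0, h0⟩ (hbdd k hk)
  have hmem : ∀ d k, k + d = M → 1 ≤ k → β k ∈ S k := by
    intro d
    induction d with
    | zero =>
      intro k hk hk1
      refine hmem_of_zero k hk1 (by omega) ?_
      rw [hS]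
      intro j hj hjk
      rw [hzero k j hj (by omega), Icc_eq_empty (by omega), sum_empty, hν]
      refine sum_nonneg fun n hn => ?_
      rw [mem_Icc] at hn
      exact hμ.1 n (by omega) hn.2
    | succ d ih =>
      intro k hk hk1
      refine hmem_of_zero k hk1 (by omega) ?_
      have hnext := ih (k + 1) (by omega) (by omega)
      rw [hS] at hnext ⊢
      intro j hj hjk
      refine le_trans ?_ (hnext j hj (by omega))
      rw [hzero k j hj (by omega), hf,
        ← add_sum_Ioc_eq_sum_Icc (show k + 1 ≤ M by omega), ← Icc_add_one_left_eq_Ioc]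
      gcongr
      exact single_le_sum (f := fun m => max (β (k + 1) - α (m - j + 1)) 0)
        (fun _ _ => le_max_right _ _) (mem_Icc.2 ⟨by omega, le_rfl⟩)
  intro k hk hkM
  refine ⟨?_, fun j _ _ h => (hcont k j).eq_of_sublevel_eq_Iic h⟩
  have hSk : S k = {t : ℝ | ∀ j ∈ Icc 1 k, f k j t ≤ ν j} := by
    simp only [hS, mem_Icc, and_imp]
  have hgreatest : IsGreatest (S k) (β k) :=
    ⟨hmem (M - k) k (by omega) hk, fun t ht => hβ k hk hkM ▸ le_csSup (hbdd k hk) ht⟩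
  rw [hSk] at hgreatest
  obtain ⟨j, hj, h⟩ :=
    exists_sublevel_eq_Iic_of_isGreatest (nonempty_Icc.2 hk) (hmono k) hgreatest
  exact ⟨j, (mem_Icc.1 hj).1, (mem_Icc.1 hj).2, h⟩
end

section
/- Let α = (α_1,…,α_M) and μ = (μ_1,…,μ_N) be nonnegative nonincreasing real sequences with M ≤ N, and let β = (β_1,…,β_M) satisfy β_k = sup S_k for all k = 1,…,M, where S_k := {t ∈ ℝ : f_{k;j}(t) ≤ ν_j for all j = 1,…,k}. For k = 1,…,M let J(k) := {j ∈ {1,…,k} : the preimage f_{k;j}^{-1}((−∞, ν_j]) equals (−∞, β_k]} and j(k) := min J(k). Then α_{k−j(k)+1} ≤ β_k for all k = 1,…,M. -/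
open Finset

theorem NonnegNonincrOn.le_of_le {M : ℕ} {a : ℕ → ℝ} (ha : NonnegNonincrOn M a) {m n : ℕ}
    (hm : 1 ≤ m) (hmn : m ≤ n) (hn : n ≤ M) : a n ≤ a m := by
  induction n, hmn using Nat.le_induction with
  | base => exact le_rfl
  | succ n hmn ih => exact (ha.2 n (by omega) (by omega)).trans (ih (by omega))

/-- A sublevel set of a continuous nondecreasing function is a closed lower ray as soon as it is
nonempty and bounded above. -/
theorem Monotone.exists_setOf_le_eq_Iic {g : ℝ → ℝ} (hg : Monotone g) (hc : Continuous g) {v : ℝ}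
    (hne : {t | g t ≤ v}.Nonempty) (hbdd : BddAbove {t | g t ≤ v}) :
    ∃ b, {t | g t ≤ v} = Set.Iic b := by
  have hmem : sSup {t | g t ≤ v} ∈ {t | g t ≤ v} :=
    (isClosed_le hc continuous_const).csSup_mem hne hbdd
  exact ⟨_, Set.Subset.antisymm (fun t ht => le_csSup hbdd ht) fun t ht => (hg ht).trans hmem⟩

/-- If finitely many sets are closed lower rays, then one of them is their intersection. -/
theorem Finset.exists_setOf_forall_mem_eq_Iic {ι : Type*} {s : Finset ι} (hs : s.Nonempty)
    {P : ι → Set ℝ} (hP : ∀ i ∈ s, ∃ b, P i = Set.Iic b) :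
    ∃ i ∈ s, ∃ b, P i = Set.Iic b ∧ {t | ∀ i ∈ s, t ∈ P i} = Set.Iic b := by
  choose! b hb using hP
  obtain ⟨i, hi, hmin⟩ := s.exists_min_image b hs
  refine ⟨i, hi, b i, hb i hi, Set.ext fun t => ⟨fun ht => hb i hi ▸ ht i hi, fun ht l hl => ?_⟩⟩
  rw [hb l hl]
  exact le_trans ht (hmin l hl)

/-- Letting `j(k)` be the smallest index `j ∈ {1, …, k}` whose constraint is active at
`β k`, we have `α (k - j(k) + 1) ≤ β k` for all `k = 1, …, M`. -/
theorem first_active_index_bound (M N : ℕ) (hM : 0 < M) (hMN : M ≤ N)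
    (α μ : ℕ → ℝ) (hα : NonnegNonincrOn M α) (hμ : NonnegNonincrOn N μ)
    (β : ℕ → ℝ) (f : ℕ → ℕ → ℝ → ℝ)
    (hf : ∀ k j (t : ℝ), f k j t =
      ∑ m ∈ Icc j k, max (t - α (m - j + 1)) 0
        + ∑ m ∈ Icc (k + 1) M, max (β m - α (m - j + 1)) 0)
    (ν : ℕ → ℝ) (hν : ∀ j, ν j = ∑ n ∈ Icc j N, μ n)
    (S : ℕ → Set ℝ)
    (hS : ∀ k, S k = {t : ℝ | ∀ j, 1 ≤ j → j ≤ k → f k j t ≤ ν j})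
    (hβ : ∀ k, 1 ≤ k → k ≤ M → β k = sSup (S k))
    (jmin : ℕ → ℕ)
    (hjmin : ∀ k, jmin k =
      sInf {j : ℕ | 1 ≤ j ∧ j ≤ k ∧ {t : ℝ | f k j t ≤ ν j} = Set.Iic (β k)}) :
    ∀ k, 1 ≤ k → k ≤ M → α (k - jmin k + 1) ≤ β k := by
  have hconst : ∀ k j, 1 ≤ j → j ≤ k → k ≤ M → ∀ t ≤ α (k - j + 1),
      f k j t = ∑ m ∈ Icc (k + 1) M, max (β m - α (m - j + 1)) 0 := by
    intro k j hj hjk hk t ht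
    rw [hf, add_eq_right]
    refine sum_eq_zero fun m hm => max_eq_right ?_
    rw [mem_Icc] at hm
    have : α (k - j + 1) ≤ α (m - j + 1) := hα.le_of_le (by omega) (by omega) (by omega)
    linarith
  have hray : ∀ k j, 1 ≤ j → j ≤ k → k ≤ M →
      ∑ m ∈ Icc (k + 1) M, max (β m - α (m - j + 1)) 0 ≤ ν j →
      ∃ b, {t : ℝ | f k j t ≤ ν j} = Set.Iic b := by
    intro k j hj hjk hk hle
    have hfun := funext (hf k j)
    refine Monotone.exists_setOf_le_eq_Iic ?_ ?_
      ⟨α (k - j + 1), (hconst k j hj hjk hk _ le_rfl).trans_le hle⟩ ⟨ν j + α 1, fun t ht => ?_⟩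
    · rw [hfun]
      intro s t hst
      dsimp only
      gcongr
    · rw [hfun]
      fun_prop
    · have h₁ : max (t - α (j - j + 1)) 0 ≤ ∑ m ∈ Icc j k, max (t - α (m - j + 1)) 0 :=
        single_le_sum (f := fun m => max (t - α (m - j + 1)) 0)
          (fun _ _ => le_max_right _ _) (left_mem_Icc.2 hjk)
      have h₂ : 0 ≤ ∑ m ∈ Icc (k + 1) M, max (β m - α (m - j + 1)) 0 :=
        sum_nonneg fun _ _ => le_max_right _ _
      have h₃ := le_max_left (t - α (j - j + 1)) 0
      have h₄ : f k j t ≤ ν j := ht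
      rw [hf] at h₄
      rw [Nat.sub_self, zero_add] at h₁ h₃
      linarith
  have hactive : ∀ k, 1 ≤ k → k ≤ M →
      (∀ j, 1 ≤ j → j ≤ k → ∑ m ∈ Icc (k + 1) M, max (β m - α (m - j + 1)) 0 ≤ ν j) →
      (∃ j, 1 ≤ j ∧ j ≤ k ∧ {t : ℝ | f k j t ≤ ν j} = Set.Iic (β k)) ∧ β k ∈ S k := by
    intro k hk hkM hle
    obtain ⟨j, hj, b, hjb, hb⟩ := Finset.exists_setOf_forall_mem_eq_Iic
      (s := Icc 1 k) (P := fun j => {t : ℝ | f k j t ≤ ν j}) ⟨1, by simpa using hk⟩ fun j hj =>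
        hray k j (mem_Icc.1 hj).1 (mem_Icc.1 hj).2 hkM (hle j (mem_Icc.1 hj).1 (mem_Icc.1 hj).2)
    have hSb : S k = Set.Iic b := by
      rw [hS, ← hb]
      simp only [mem_Icc, and_imp, Set.mem_ofPred_eq]
    have hβb : β k = b := by rw [hβ k hk hkM, hSb, csSup_Iic]
    rw [hβb, hSb]
    exact ⟨⟨j, (mem_Icc.1 hj).1, (mem_Icc.1 hj).2, hjb⟩, Set.self_mem_Iic⟩
  have htail : ∀ k ≤ M, ∀ j, 1 ≤ j → j ≤ k →
      ∑ m ∈ Icc (k + 1) M, max (β m - α (m - j + 1)) 0 ≤ ν j := by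
    intro k hkM
    induction hkM using Nat.decreasingInduction with
    | self =>
      intro j hj _
      rw [Icc_eq_empty (by omega), sum_empty, hν]
      exact sum_nonneg fun n hn => hμ.1 n (hj.trans (mem_Icc.1 hn).1) (mem_Icc.1 hn).2
    | of_succ k hk ih =>
      intro j hj hjk
      have hmem := (hactive (k + 1) (by omega) hk ih).2
      rw [hS] at hmem
      have hle := hmem j hj (by omega)
      rw [hf, sum_Icc_succ_top (by omega)] at hle
      have hnn : 0 ≤ ∑ m ∈ Icc j k, max (β (k + 1) - α (m - j + 1)) 0 :=
        sum_nonneg fun _ _ => le_max_right _ _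
      rw [← add_sum_Ioc_eq_sum_Icc hk, ← Icc_add_one_left_eq_Ioc]
      linarith
  intro k hk hkM
  obtain ⟨h₁, h₂, heq⟩ : jmin k ∈
      {j : ℕ | 1 ≤ j ∧ j ≤ k ∧ {t : ℝ | f k j t ≤ ν j} = Set.Iic (β k)} := by
    rw [hjmin k]
    exact Nat.sInf_mem (hactive k hk hkM (htail k hkM)).1
  rw [← Set.mem_Iic, ← heq]
  exact (hconst k _ h₁ h₂ hkM _ le_rfl).trans_le (htail k hkM _ h₁ h₂)
end

section
/- Let α = (α_1,…,α_M) and μ = (μ_1,…,μ_N) be nonnegative nonincreasing real sequences with M ≤ N, and let β = (β_1,…,β_M) satisfy β_k = sup S_k for all k = 1,…,M, where S_k := {t ∈ ℝ : f_{k;j}(t) ≤ ν_j for all j = 1,…,k}. For k = 1,…,M let J(k) := {j ∈ {1,…,k} : the preimage f_{k;j}^{-1}((−∞, ν_j]) equals (−∞, β_k]} and j(k) := min J(k). Then j(k) ≤ j(k+1) for all k = 1,…,M−1. -/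
open Finset

theorem NonnegNonincrOn.le_of_le_s18 {M : ℕ} {a : ℕ → ℝ} (h : NonnegNonincrOn M a) {i j : ℕ}
    (hi : 1 ≤ i) (hij : i ≤ j) (hj : j ≤ M) : a j ≤ a i := by
  induction j, hij using Nat.le_induction with
  | base => exact le_rfl
  | succ n hn ih => exact (h.2 n (by omega) (by omega)).trans (ih (by omega))

theorem Monotone.exists_gt_of_sublevel_ne_Iic {g : ℝ → ℝ} (hg : Monotone g) {b c : ℝ}
    (hb : g b ≤ c) (hne : {t | g t ≤ c} ≠ Set.Iic b) : ∃ t, b < t ∧ g t ≤ c := by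
  by_contra! h
  refine hne (Set.ext fun t => ⟨fun ht => ?_, fun ht => (hg ht).trans hb⟩)
  by_contra hlt
  exact (h t (not_le.1 hlt)).not_ge ht

/-- If `b` is the greatest point satisfying finitely many monotone constraints, then some single
constraint already cuts out `Set.Iic b`. -/
theorem exists_sublevel_eq_Iic {ι : Type*} {s : Finset ι} (hs : s.Nonempty) {g : ι → ℝ → ℝ}
    (hg : ∀ j ∈ s, Monotone (g j)) {c : ι → ℝ} {b : ℝ}
    (hb : IsGreatest {t | ∀ j ∈ s, g j t ≤ c j} b) :
    ∃ j ∈ s, {t | g j t ≤ c j} = Set.Iic b := by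
  by_contra! h
  have hex : ∀ j, ∃ t, j ∈ s → b < t ∧ g j t ≤ c j := fun j => by
    by_cases hj : j ∈ s
    · obtain ⟨t, ht⟩ := (hg j hj).exists_gt_of_sublevel_ne_Iic (hb.1 j hj) (h j hj)
      exact ⟨t, fun _ => ht⟩
    · exact ⟨0, fun hj' => absurd hj' hj⟩
  choose t ht using hex
  obtain ⟨i, hi, hmin⟩ := s.exists_min_image t hs
  have hle : t i ≤ b := hb.2 fun j hj => (hg j hj (hmin j hj)).trans (ht j hj).2
  exact hle.not_gt (ht i hi).1

/-- At the right end of its sublevel set, a continuous function attains the level. -/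
theorem le_of_sublevel_eq_Iic {g : ℝ → ℝ} (hg : Continuous g) {b c : ℝ}
    (h : {t | g t ≤ c} = Set.Iic b) : c ≤ g b := by
  refine ge_of_tendsto (hg.continuousWithinAt (s := Set.Ioi b) (x := b)) ?_
  filter_upwards [self_mem_nhdsWithin] with t ht
  by_contra hlt
  have : t ∈ Set.Iic b := h ▸ (not_le.1 hlt).le
  exact (Set.mem_Iic.1 this).not_gt ht

/-- Letting `j(k)` be the smallest index `j ∈ {1, …, k}` whose constraint is active at
`β k`, the map `k ↦ j(k)` is nondecreasing: `j(k) ≤ j(k+1)` for `k = 1, …, M-1`. -/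
theorem first_active_index_mono (M N : ℕ) (hM : 0 < M) (hMN : M ≤ N)
    (α μ : ℕ → ℝ) (hα : NonnegNonincrOn M α) (hμ : NonnegNonincrOn N μ)
    (β : ℕ → ℝ) (f : ℕ → ℕ → ℝ → ℝ)
    (hf : ∀ k j (t : ℝ), f k j t =
      ∑ m ∈ Icc j k, max (t - α (m - j + 1)) 0
        + ∑ m ∈ Icc (k + 1) M, max (β m - α (m - j + 1)) 0)
    (ν : ℕ → ℝ) (hν : ∀ j, ν j = ∑ n ∈ Icc j N, μ n)
    (S : ℕ → Set ℝ)
    (hS : ∀ k, S k = {t : ℝ | ∀ j, 1 ≤ j → j ≤ k → f k j t ≤ ν j})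
    (hβ : ∀ k, 1 ≤ k → k ≤ M → β k = sSup (S k))
    (jmin : ℕ → ℕ)
    (hjmin : ∀ k, jmin k =
      sInf {j : ℕ | 1 ≤ j ∧ j ≤ k ∧ {t : ℝ | f k j t ≤ ν j} = Set.Iic (β k)}) :
    ∀ k, 1 ≤ k → k < M → jmin k ≤ jmin (k + 1) := by
  have hcont : ∀ k j, Continuous (f k j) := fun k j => by
    rw [funext (hf k j)]
    fun_prop
  have hmono : ∀ k j, Monotone (f k j) := fun k j s t hst => by
    rw [hf, hf]
    gcongr
  have hstep : ∀ k j, j ≤ k → k < M → f k j (β (k + 1)) = f (k + 1) j (β (k + 1)) := by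
    intro k j hjk hkM
    rw [hf, hf, ← Finset.insert_Icc_add_one_left_eq_Icc (show k + 1 ≤ M from hkM),
      ← Finset.insert_Icc_right_eq_Icc_add_one (show j ≤ k + 1 by omega),
      Finset.sum_insert (by simp), Finset.sum_insert (by simp)]
    ring
  have hclosed : ∀ k, IsClosed (S k) := fun k => by
    rw [hS]
    simp only [Set.ofPred_forall]
    exact isClosed_iInter fun j => isClosed_iInter fun _ => isClosed_iInter fun _ =>
      isClosed_le (hcont k j) continuous_const
  have hbdd : ∀ k, 1 ≤ k → BddAbove (S k) := by
    refine fun k hk => ⟨ν k + α 1, fun t ht => ?_⟩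
    rw [hS] at ht
    have hle := ht k hk le_rfl
    rw [hf] at hle
    have hnn : 0 ≤ ∑ m ∈ Icc (k + 1) M, max (β m - α (m - k + 1)) 0 :=
      Finset.sum_nonneg fun _ _ => le_max_right _ _
    simp only [Finset.Icc_self, Finset.sum_singleton, Nat.sub_self, zero_add] at hle
    linarith [le_max_left (t - α 1) 0]
  have hgreatest_of_nonempty : ∀ k, 1 ≤ k → k ≤ M → (S k).Nonempty → IsGreatest (S k) (β k) := by
    intro k hk hkM hne
    rw [hβ k hk hkM]
    exact ⟨(hclosed k).csSup_mem hne (hbdd k hk), fun t ht => le_csSup (hbdd k hk) ht⟩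
  have hνnn : ∀ j, 1 ≤ j → 0 ≤ ν j := fun j hj => by
    rw [hν]
    refine Finset.sum_nonneg fun n hn => ?_
    rw [Finset.mem_Icc] at hn
    exact hμ.1 n (by omega) hn.2
  have hzero : (0 : ℝ) ∈ S M := by
    rw [hS]
    intro j hj hjM
    rw [hf, Finset.Icc_eq_empty (by omega : ¬ M + 1 ≤ M), Finset.sum_empty, add_zero,
      Finset.sum_eq_zero]
    · exact hνnn j hj
    · intro m hm
      rw [Finset.mem_Icc] at hm
      have := hα.1 (m - j + 1) (by omega) (by omega)
      exact max_eq_right (by linarith)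
  have hsucc_mem : ∀ k, k < M → β (k + 1) ∈ S (k + 1) → β (k + 1) ∈ S k := by
    intro k hkM hmem
    rw [hS] at hmem ⊢
    exact fun j hj hjk => (hstep k j hjk hkM).trans_le (hmem j hj (by omega))
  have hgreatest : ∀ k, k ≤ M → 1 ≤ k → IsGreatest (S k) (β k) := by
    intro k hkM
    induction hkM using Nat.decreasingInduction with
    | self => exact fun hk => hgreatest_of_nonempty M hk le_rfl ⟨0, hzero⟩
    | of_succ k hkM ih =>
      exact fun hk => hgreatest_of_nonempty k hk hkM.le
        ⟨_, hsucc_mem k hkM (ih (by omega)).1⟩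
  intro k hk hkM
  have hactive : ∃ j ∈ Icc 1 (k + 1), {t | f (k + 1) j t ≤ ν j} = Set.Iic (β (k + 1)) := by
    refine exists_sublevel_eq_Iic (Finset.nonempty_Icc.2 (by omega)) (fun j _ => hmono (k + 1) j) ?_
    simpa [hS] using hgreatest (k + 1) hkM (by omega)
  have hne : {j : ℕ | 1 ≤ j ∧ j ≤ k + 1 ∧
      {t : ℝ | f (k + 1) j t ≤ ν j} = Set.Iic (β (k + 1))}.Nonempty := by
    obtain ⟨j, hj, hj'⟩ := hactive
    rw [Finset.mem_Icc] at hj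
    exact ⟨j, hj.1, hj.2, hj'⟩
  have hp := Nat.sInf_mem hne
  rw [← hjmin] at hp
  obtain ⟨hp1, -, hpeq⟩ := hp
  by_contra! hlt
  have hq := Nat.sInf_mem (Nat.nonempty_of_pos_sInf ((by omega : 0 < jmin k).trans_eq (hjmin k)))
  rw [← hjmin] at hq
  obtain ⟨-, hqk, hqeq⟩ := hq
  have hpnot : {t : ℝ | f k (jmin (k + 1)) t ≤ ν (jmin (k + 1))} ≠ Set.Iic (β k) := fun h =>
    Nat.notMem_of_lt_sInf (hlt.trans_eq (hjmin k)) ⟨hp1, by omega, h⟩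
  generalize jmin (k + 1) = p at *
  generalize jmin k = q at *
  have hgk := hgreatest k hkM.le hk
  have hβle : β (k + 1) ≤ β k := hgk.2 (hsucc_mem k hkM (hgreatest (k + 1) hkM (by omega)).1)
  have hmem := hgk.1
  rw [hS] at hmem
  obtain ⟨t, hβt, htp⟩ :=
    (hmono k p).exists_gt_of_sublevel_ne_Iic (hmem p hp1 (by omega)) hpnot
  have hνp := le_of_sublevel_eq_Iic (hcont (k + 1) p) hpeq
  rw [← hstep k p (by omega) hkM] at hνp
  -- `f k p` is constant on `[β (k + 1), t]`, so none of its positive parts is active there.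
  have htα : t ≤ α (k - p + 1) := by
    by_contra! hαt
    refine (htp.trans hνp).not_gt ?_
    rw [hf, hf]
    gcongr ?_ + _
    refine Finset.sum_lt_sum (fun m _ => by gcongr; linarith)
      ⟨k, Finset.mem_Icc.2 ⟨by omega, le_rfl⟩, ?_⟩
    exact max_lt_iff.2 ⟨lt_max_of_lt_left (by linarith), lt_max_of_lt_left (by linarith)⟩
  have hsum : ∀ s ≤ t, ∑ m ∈ Icc q k, max (s - α (m - q + 1)) 0 = 0 := by
    refine fun s hs => Finset.sum_eq_zero fun m hm => ?_
    rw [Finset.mem_Icc] at hm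
    have := hα.le_of_le_s18 (i := m - q + 1) (j := k - p + 1) (by omega) (by omega) (by omega)
    exact max_eq_right (by linarith)
  have hconst : f k q t = f k q (β k) := by
    rw [hf, hf, hsum t le_rfl, hsum _ hβt.le]
  have ht : t ∈ Set.Iic (β k) := by
    rw [← hqeq]
    exact hconst.trans_le (hmem q (by omega) hqk)
  exact hβt.not_ge ht
end
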